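/- Let W_ll : ℕ → [0,∞) be defined by W_ll(N) = log log N for N ≥ 3 and W_ll(N) = 0 for N ≤ 2. Then the supremum, over all functions f : ℕ → ℂ with ‖f‖∞ ≤ 1, of | E^{W_ll}_{n≤N} f(Ω(n)) − (1/⌊log log N⌋) ∑_{n=1}^{⌊log log N⌋} f(n) | tends to 0 as N → ∞. -/

import Mathlib

open Filter Finset

/-- Discrete derivative: `ΔW(N) = W(N) - W(N-1)` for `N ≥ 2`, and `ΔW(1) = W(1)`. -/
noncomputable def dd (W : ℕ → ℝ) (N : ℕ) : ℝ := if 2 ≤ N then W N - W (N - 1) else W 1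

/-- Weighted average `E^W_{n ≤ N} f(n) = (1/W(N)) ∑_{n=1}^N ΔW(n) f(n)`. -/
noncomputable def wAvg (W : ℕ → ℝ) (f : ℕ → ℂ) (N : ℕ) : ℂ :=
  (1 / (W N : ℂ)) * ∑ n ∈ Finset.Icc 1 N, (dd W n : ℂ) * f n

/-- Cesàro average `E_{n ≤ N} f(n) = (1/N) ∑_{n=1}^N f(n)`. -/
noncomputable def cesaro (f : ℕ → ℂ) (N : ℕ) : ℂ :=
  (1 / (N : ℂ)) * ∑ n ∈ Finset.Icc 1 N, f n

/-- Parity-neutral binomial mean. -/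
noncomputable def e2bin (f : ℕ → ℂ) (N : ℕ) : ℂ :=
  (1 / 2 ^ (N + 1) : ℂ) * ∑ n ∈ Finset.Icc 1 (2 * N), (Nat.choose N (n / 2) : ℂ) * f n

/-- Binomial mean. -/
noncomputable def ebin (f : ℕ → ℂ) (N : ℕ) : ℂ :=
  (1 / 2 ^ N : ℂ) * ∑ n ∈ Finset.Icc 1 N, (Nat.choose N n : ℂ) * f n

/-- The class 𝒲: eventually non-decreasing nonnegative functions tending to ∞. -/
def memW (W : ℕ → ℝ) : Prop :=
  (∀ n, 0 ≤ W n) ∧ (∃ N₀ : ℕ, ∀ m n : ℕ, N₀ ≤ m → m ≤ n → W m ≤ W n) ∧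
    Tendsto W atTop atTop

/-- The class 𝒲*: members of 𝒲 for which `N·Δ²W(N)/ΔW(N)` converges in `ℝ ∪ {±∞}`. -/
def memWstar (W : ℕ → ℝ) : Prop :=
  memW W ∧ ∃ l : EReal,
    Tendsto (fun N : ℕ => (((N : ℝ) * dd (dd W) N / dd W N : ℝ) : EReal)) atTop (nhds l)

/-- The class ℒ: members of 𝒲 (with values in ℕ) whose discrete derivative is
eventually in {0,1}. -/
def memL (L : ℕ → ℕ) : Prop :=
  memW (fun n => (L n : ℝ)) ∧
    ∃ N₀ : ℕ, ∀ n : ℕ, N₀ ≤ n → L n = L (n - 1) ∨ L n = L (n - 1) + 1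

/-- Gaussian probability density with mean μ and standard deviation σ. -/
noncomputable def gauss (x μ σ : ℝ) : ℝ :=
  (1 / (σ * Real.sqrt (2 * Real.pi))) * Real.exp (-(x - μ) ^ 2 / (2 * σ ^ 2))

/-- The Gaussian condition \eqref{gaussian_condition}. -/
def gaussCond (ϑ : ℕ → ℕ) (L : ℕ → ℕ) : Prop :=
  Tendsto (fun N : ℕ => ∑' k : ℕ,
      |(((Finset.Icc 1 N).filter (fun n => ϑ n = k + 1)).card : ℝ) / N -
        gauss (k + 1 : ℝ) (L N) (Real.sqrt (L N))|) atTop (nhds 0)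

/-- Ω(n): number of prime factors with multiplicity. -/
def bigOmega (n : ℕ) : ℕ := n.primeFactorsList.length

/-- ω(n): number of distinct prime factors. -/
def smallOmega (n : ℕ) : ℕ := n.primeFactors.card

/-- Uniform distribution mod 1. -/
def udMod1 (x : ℕ → ℝ) : Prop :=
  ∀ a b : ℝ, 0 ≤ a → a < b → b ≤ 1 →
    Tendsto (fun N : ℕ =>
        (((Finset.Icc 1 N).filter
            (fun n => a ≤ Int.fract (x n) ∧ Int.fract (x n) < b)).card : ℝ) / N)
      atTop (nhds (b - a))

open scoped ArithmeticFunction.vonMangoldt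

/-! ### Partial summation and the logarithmic weights -/

/-- Abel's inequality: partial sums bounded above by `C` against decreasing nonnegative weights. -/
theorem sum_mul_le_of_partial_sums_le {k n : ℕ} {a w : ℕ → ℝ} {C : ℝ} (hkn : k ≤ n)
    (ha : ∀ m, k ≤ m → m ≤ n → ∑ i ∈ Icc k m, a i ≤ C)
    (hw : ∀ m, k ≤ m → m < n → w (m + 1) ≤ w m) (h0 : 0 ≤ w n) :
    ∑ i ∈ Icc k n, a i * w i ≤ C * w k := by
  have key : ∀ l, k ≤ l → l ≤ n →
      ∑ i ∈ Icc k l, a i * w i ≤ (∑ i ∈ Icc k l, a i) * w l + C * (w k - w l) := by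
    intro l hl
    induction l, hl using Nat.le_induction with
    | base => intro _; simp
    | succ l hl ih =>
      intro hln
      rw [← Finset.insert_Icc_right_eq_Icc_add_one (by omega),
        Finset.sum_insert (by simp), Finset.sum_insert (by simp)]
      have h1 := ih (by omega)
      have h2 := ha l hl (by omega)
      have h3 := hw l hl (by omega)
      nlinarith [mul_nonneg (sub_nonneg.2 h2) (sub_nonneg.2 h3)]
  have h1 := key n hkn le_rfl
  have h2 := mul_le_mul_of_nonneg_right (ha n hkn le_rfl) h0
  linarith

/-- Two-sided form of Abel's inequality. -/
theorem abs_sum_mul_le_of_abs_partial_sums_le {k n : ℕ} {a w : ℕ → ℝ} {C : ℝ} (hkn : k ≤ n)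
    (ha : ∀ m, k ≤ m → m ≤ n → |∑ i ∈ Icc k m, a i| ≤ C)
    (hw : ∀ m, k ≤ m → m < n → w (m + 1) ≤ w m) (h0 : 0 ≤ w n) :
    |∑ i ∈ Icc k n, a i * w i| ≤ C * w k := by
  rw [abs_le']
  refine ⟨sum_mul_le_of_partial_sums_le hkn (fun m h1 h2 => (abs_le.1 (ha m h1 h2)).2) hw h0,
    ?_⟩
  have := sum_mul_le_of_partial_sums_le (a := fun i => -a i) (C := C) hkn
    (fun m h1 h2 => by
      rw [Finset.sum_neg_distrib]; linarith [(abs_le.1 (ha m h1 h2)).1]) hw h0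
  simpa [Finset.sum_neg_distrib] using this

theorem log_add_one_sub_log_mem {d : ℕ} (hd : 1 ≤ d) :
    1 / ((d : ℝ) + 1) ≤ Real.log (d + 1) - Real.log d ∧
      Real.log (d + 1) - Real.log d ≤ 1 / d := by
  have hd' : (0 : ℝ) < d := by exact_mod_cast hd
  rw [← Real.log_div (by positivity) (by positivity)]
  constructor
  · have := Real.one_sub_inv_le_log_of_pos (x := ((d : ℝ) + 1) / d) (by positivity)
    have h : 1 - (((d : ℝ) + 1) / d)⁻¹ = 1 / (d + 1) := by field_simp; ring
    linarith
  · have := Real.log_le_sub_one_of_pos (x := ((d : ℝ) + 1) / d) (by positivity)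
    have h : ((d : ℝ) + 1) / d - 1 = 1 / d := by field_simp; ring
    linarith

theorem one_div_log_sub_mem {d : ℕ} {t : ℝ} (hd : 1 ≤ d) (ht : 0 < Real.log d + t) :
    1 / ((d + 1 : ℝ) * (Real.log (d + 1) + t) ^ 2) ≤
        1 / (Real.log d + t) - 1 / (Real.log (d + 1) + t) ∧
      1 / (Real.log d + t) - 1 / (Real.log (d + 1) + t) ≤ 1 / (d * (Real.log d + t) ^ 2) := by
  obtain ⟨h1, h2⟩ := log_add_one_sub_log_mem hd
  have hd' : (0 : ℝ) < d := by exact_mod_cast hd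
  set x := Real.log d + t
  set y := Real.log (d + 1) + t with hy
  have hxy : y - x = Real.log (d + 1) - Real.log d := by simp [x, y]
  rw [← hxy] at h1 h2
  have hlt : x < y := by
    have : 0 < 1 / ((d : ℝ) + 1) := by positivity
    linarith
  have hy0 : 0 < y := ht.trans hlt
  have e : 1 / x - 1 / y = (y - x) / (x * y) := by field_simp
  rw [e]
  rw [← div_div, ← div_div 1 (d : ℝ)]
  exact ⟨div_le_div₀ (by linarith) h1 (by positivity) (by nlinarith),
    div_le_div₀ (by positivity) h2 (by positivity) (by nlinarith)⟩

theorem log_log_sub_mem {d : ℕ} (hd : 2 ≤ d) :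
    1 / ((d + 1 : ℝ) * Real.log (d + 1)) ≤
        Real.log (Real.log (d + 1)) - Real.log (Real.log d) ∧
      Real.log (Real.log (d + 1)) - Real.log (Real.log d) ≤ 1 / (d * Real.log d) := by
  obtain ⟨h1, h2⟩ := log_add_one_sub_log_mem (d := d) (by omega)
  have hd' : (2 : ℝ) ≤ d := by exact_mod_cast hd
  have hx : 0 < Real.log d := Real.log_pos (by linarith)
  have hy : 0 < Real.log (d + 1) := Real.log_pos (by linarith)
  set x := Real.log d
  set y := Real.log (d + 1)
  rw [← Real.log_div (by positivity) (by positivity)]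
  constructor
  · refine le_trans ?_ (Real.one_sub_inv_le_log_of_pos (by positivity))
    have : 1 - (y / x)⁻¹ = (y - x) / y := by field_simp
    rw [this, ← div_div]
    gcongr
  · refine le_trans (Real.log_le_sub_one_of_pos (by positivity)) ?_
    have : y / x - 1 = (y - x) / x := by field_simp
    rw [this, ← div_div]
    gcongr

theorem sum_one_div_mul_log_sq_le (N : ℕ) :
    ∑ n ∈ Icc 2 N, 1 / ((n : ℝ) * Real.log n ^ 2) ≤
      1 / (2 * Real.log 2 ^ 2) + 1 / Real.log 2 := by
  have hl := Real.log_pos one_lt_two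
  rcases lt_or_ge N 2 with h | h
  · rw [Finset.Icc_eq_empty (by omega), Finset.sum_empty]; positivity
  have key : ∑ n ∈ Icc 2 N, 1 / ((n : ℝ) * Real.log n ^ 2) ≤
      1 / (2 * Real.log 2 ^ 2) + 1 / Real.log 2 - 1 / Real.log N := by
    induction N, h using Nat.le_induction with
    | base => simp
    | succ N h ih =>
      rw [← Finset.insert_Icc_right_eq_Icc_add_one (by omega), Finset.sum_insert (by simp)]
      have hN : (2 : ℝ) ≤ N := by exact_mod_cast h
      have := (one_div_log_sub_mem (d := N) (t := 0) (by omega)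
        (by simpa using Real.log_pos (by linarith))).1
      push_cast
      simp only [add_zero] at this
      linarith
  have hN : (2 : ℝ) ≤ N := by exact_mod_cast h
  have : 0 ≤ 1 / Real.log N := one_div_nonneg.2 (Real.log_nonneg (by linarith))
  linarith

theorem abs_sum_one_div_sub_log_le {N : ℕ} (hN : 1 ≤ N) :
    |∑ n ∈ Icc 1 N, 1 / (n : ℝ) - Real.log N| ≤ 1 := by
  have h : ((harmonic N : ℚ) : ℝ) = ∑ n ∈ Icc 1 N, 1 / (n : ℝ) := by
    rw [harmonic_eq_sum_Icc]; push_cast; simp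
  have h1 := log_add_one_le_harmonic N
  have h2 := harmonic_le_one_add_log N
  have h3 : Real.log N ≤ Real.log (↑(N + 1) : ℝ) :=
    Real.log_le_log (by exact_mod_cast hN) (by push_cast; linarith)
  rw [h] at h1 h2
  rw [abs_le]; constructor <;> linarith

theorem abs_sum_one_div_mul_log_sub_log_log_le :
    ∃ C : ℝ, ∀ N : ℕ, 2 ≤ N →
      |∑ n ∈ Icc 2 N, 1 / ((n : ℝ) * Real.log n) - Real.log (Real.log N)| ≤ C := by
  have hl := Real.log_pos one_lt_two
  have key : ∀ N : ℕ, 2 ≤ N →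
      0 ≤ ∑ n ∈ Icc 2 N, 1 / ((n : ℝ) * Real.log n) - 1 / (N * Real.log N) -
        (Real.log (Real.log N) - Real.log (Real.log 2)) ∧
      ∑ n ∈ Icc 2 N, 1 / ((n : ℝ) * Real.log n) - 1 / (2 * Real.log 2) ≤
        Real.log (Real.log N) - Real.log (Real.log 2) := by
    intro N h
    induction N, h using Nat.le_induction with
    | base => simp
    | succ N h ih =>
      rw [← Finset.insert_Icc_right_eq_Icc_add_one (by omega), Finset.sum_insert (by simp)]
      have := log_log_sub_mem h
      push_cast
      constructor <;> linarith [ih.1, ih.2, this.1, this.2]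
  refine ⟨1 / (2 * Real.log 2) + |Real.log (Real.log 2)|, fun N h => ?_⟩
  obtain ⟨h1, h2⟩ := key N h
  have hN : (2 : ℝ) ≤ N := by exact_mod_cast h
  have h3 : 0 ≤ 1 / (N * Real.log N) :=
    one_div_nonneg.2 (mul_nonneg (by linarith) (Real.log_nonneg (by linarith)))
  have h4 := neg_abs_le (Real.log (Real.log 2))
  have h5 := le_abs_self (Real.log (Real.log 2))
  have h6 : 0 ≤ 1 / (2 * Real.log 2) := by positivity
  rw [abs_le]; constructor <;> linarith

/-! ### Mertens-type estimates -/

theorem sum_vonMangoldt_mul_div (N : ℕ) :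
    ∑ d ∈ Icc 1 N, Λ d * ((N / d : ℕ) : ℝ) = Real.log (N.factorial : ℝ) := by
  have h := ArithmeticFunction.sum_Ioc_mul_zeta_eq_sum (R := ℝ) Λ N
  rw [ArithmeticFunction.vonMangoldt_mul_zeta] at h
  have hI : Ioc 0 N = Icc 1 N := rfl
  rw [hI] at h
  rw [← h]
  clear h hI
  induction N with
  | zero => simp
  | succ N ih =>
    rw [← Finset.insert_Icc_right_eq_Icc_add_one (by omega), Finset.sum_insert (by simp), ih,
      Nat.factorial_succ, Nat.cast_mul, Real.log_mul (by positivity) (by positivity)]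
    rfl

theorem sum_vonMangoldt_le (N : ℕ) :
    ∑ d ∈ Icc 1 N, Λ d ≤ (Real.log 4 + 4) * N := by
  have := Chebyshev.psi_le_const_mul_self (x := N) (by positivity)
  rw [Chebyshev.psi, Nat.floor_natCast] at this
  exact this

theorem abs_sum_vonMangoldt_div_sub_log_le :
    ∃ C : ℝ, ∀ N : ℕ, 1 ≤ N → |∑ d ∈ Icc 1 N, Λ d / d - Real.log N| ≤ C := by
  refine ⟨Real.log 4 + 4, fun N hN => ?_⟩
  have hN' : (0 : ℝ) < N := by exact_mod_cast hN
  have h4 : 0 < Real.log 4 := Real.log_pos (by norm_num)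
  have h1 : Real.log (N.factorial : ℝ) ≤ N * Real.log N := by
    rw [← Real.log_pow]
    exact Real.log_le_log (by positivity) (by exact_mod_cast Nat.factorial_le_pow N)
  have h2 : N * Real.log N - N ≤ Real.log (N.factorial : ℝ) := by
    have := Stirling.le_log_factorial_stirling (n := N) (by omega)
    have h3 : 0 ≤ Real.log N := Real.log_nonneg (by exact_mod_cast hN)
    have h5 : 0 ≤ Real.log (2 * Real.pi) := Real.log_nonneg (by linarith [Real.pi_gt_three])
    linarith
  rw [← sum_vonMangoldt_mul_div] at h1 h2
  have h3 : ∑ d ∈ Icc 1 N, Λ d * ((N / d : ℕ) : ℝ) ≤ N * ∑ d ∈ Icc 1 N, Λ d / d := by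
    rw [Finset.mul_sum]
    refine Finset.sum_le_sum fun d _ => ?_
    have := mul_le_mul_of_nonneg_left (Nat.cast_div_le (α := ℝ) (m := N) (n := d))
      (ArithmeticFunction.vonMangoldt_nonneg (n := d))
    refine this.trans (le_of_eq ?_)
    ring
  have h5 : N * ∑ d ∈ Icc 1 N, Λ d / d ≤
      ∑ d ∈ Icc 1 N, Λ d * ((N / d : ℕ) : ℝ) + ∑ d ∈ Icc 1 N, Λ d := by
    rw [Finset.mul_sum, ← Finset.sum_add_distrib]
    refine Finset.sum_le_sum fun d hd => ?_
    have hd' := (Finset.mem_Icc.1 hd).1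
    have h6 : (N : ℝ) / d ≤ ((N / d : ℕ) : ℝ) + 1 := by
      have := Nat.lt_floor_add_one ((N : ℝ) / d)
      rw [Nat.floor_div_natCast, Nat.floor_natCast] at this
      exact this.le
    have := mul_le_mul_of_nonneg_left h6 (ArithmeticFunction.vonMangoldt_nonneg (n := d))
    calc (N : ℝ) * (Λ d / d) = Λ d * (N / d) := by ring
      _ ≤ _ := by linarith
  have h6 := sum_vonMangoldt_le N
  set S := ∑ d ∈ Icc 1 N, Λ d / d
  rw [abs_le]
  constructor
  · refine le_of_mul_le_mul_left ?_ hN'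
    nlinarith
  · refine le_of_mul_le_mul_left ?_ hN'
    nlinarith

theorem sum_vonMangoldt_nonprime_div_le :
    ∃ C : ℝ, ∀ N : ℕ, ∑ d ∈ Icc 1 N, (if d.Prime then 0 else Λ d) / (d : ℝ) ≤ C := by
  have h := ArithmeticFunction.vonMangoldt.summable_residueClass_non_primes_div
    (q := 1) (a := (1 : ZMod 1))
  have e : (fun n : ℕ => (if n.Prime then 0 else
      ArithmeticFunction.vonMangoldt.residueClass (1 : ZMod 1) n) / (n : ℝ)) =
      fun n : ℕ => (if n.Prime then 0 else Λ n) / (n : ℝ) := by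
    funext n
    have : n ∈ {n : ℕ | (n : ZMod 1) = 1} := Subsingleton.elim (n : ZMod 1) 1
    rw [ArithmeticFunction.vonMangoldt.residueClass, Set.indicator_of_mem this]
  rw [e] at h
  refine ⟨_, fun N => h.sum_le_tsum _ fun d _ => ?_⟩
  have := ArithmeticFunction.vonMangoldt_nonneg (n := d)
  split_ifs <;> positivity

theorem abs_sum_vonMangoldt_sub_one_div_le :
    ∃ C : ℝ, ∀ N : ℕ, |∑ d ∈ Icc 1 N, (Λ d - 1) / d| ≤ C := by
  obtain ⟨C, hC⟩ := abs_sum_vonMangoldt_div_sub_log_le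
  refine ⟨C + 1, fun N => ?_⟩
  have hC0 : 0 ≤ C := (abs_nonneg _).trans (hC 1 le_rfl)
  rcases Nat.eq_zero_or_pos N with rfl | hN
  · simp; linarith
  have h1 := abs_le.1 (hC N hN)
  have h2 := abs_le.1 (abs_sum_one_div_sub_log_le hN)
  simp only [sub_div, Finset.sum_sub_distrib]
  rw [abs_le]
  constructor <;> linarith [h1.1, h1.2, h2.1, h2.2]

theorem abs_sum_prime_one_div_sub_log_log_le :
    ∃ C : ℝ, ∀ N : ℕ, 2 ≤ N →
      |∑ p ∈ Icc 1 N with p.Prime, 1 / (p : ℝ) - Real.log (Real.log N)| ≤ C := by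
  obtain ⟨C₁, h₁⟩ := abs_sum_vonMangoldt_sub_one_div_le
  obtain ⟨C₂, h₂⟩ := sum_vonMangoldt_nonprime_div_le
  obtain ⟨C₃, h₃⟩ := abs_sum_one_div_mul_log_sub_log_log_le
  refine ⟨(C₁ + C₂ + 1) * (1 / Real.log 2) + C₃, fun N hN => ?_⟩
  have hl := Real.log_pos one_lt_two
  have hsplit : ∀ (M : ℕ) (f : ℕ → ℝ), 1 ≤ M →
      ∑ i ∈ Icc 1 M, f i = f 1 + ∑ i ∈ Icc 2 M, f i := fun M f hM => by
    rw [← Finset.insert_Icc_add_one_left_eq_Icc hM, Finset.sum_insert (by simp)]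
    rfl
  have key : |∑ d ∈ Icc 2 N, ((if d.Prime then Λ d else 0) - 1) / (d : ℝ) * (1 / Real.log d)| ≤
      (C₁ + C₂ + 1) * (1 / Real.log (2 : ℕ)) := by
    refine abs_sum_mul_le_of_abs_partial_sums_le (w := fun d : ℕ => 1 / Real.log d) hN ?_ ?_ ?_
    · intro m hm _
      have h4 := abs_le.1 (h₁ m)
      have h5 := h₂ m
      have h6 : 0 ≤ ∑ d ∈ Icc 1 m, (if d.Prime then 0 else Λ d) / (d : ℝ) :=
        Finset.sum_nonneg fun d _ => by
          have := ArithmeticFunction.vonMangoldt_nonneg (n := d)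
          split_ifs <;> positivity
      have e : ∑ d ∈ Icc 2 m, ((if d.Prime then Λ d else 0) - 1) / (d : ℝ) =
          ∑ d ∈ Icc 1 m, (Λ d - 1) / (d : ℝ) -
            ∑ d ∈ Icc 1 m, (if d.Prime then 0 else Λ d) / (d : ℝ) + 1 := by
        rw [← Finset.sum_sub_distrib, hsplit m _ (by omega)]
        have : ∀ d : ℕ, (Λ d - 1) / (d : ℝ) - (if d.Prime then 0 else Λ d) / (d : ℝ) =
            ((if d.Prime then Λ d else 0) - 1) / (d : ℝ) := fun d => by
          split_ifs <;> ring
        simp only [this]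
        simp [Nat.not_prime_one]
      rw [e, abs_le]
      constructor <;> linarith [h4.1, h4.2]
    · intro m hm _
      have hm' : (2 : ℝ) ≤ m := by exact_mod_cast hm
      have : 0 < Real.log m := Real.log_pos (by linarith)
      push_cast
      gcongr
      linarith
    · exact one_div_nonneg.2 (Real.log_natCast_nonneg _)
  have e : ∑ d ∈ Icc 2 N, ((if d.Prime then Λ d else 0) - 1) / (d : ℝ) * (1 / Real.log d) =
      ∑ p ∈ Icc 1 N with p.Prime, 1 / (p : ℝ) - ∑ n ∈ Icc 2 N, 1 / ((n : ℝ) * Real.log n) := by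
    rw [Finset.sum_filter, hsplit N _ (by omega), if_neg Nat.not_prime_one, zero_add,
      ← Finset.sum_sub_distrib]
    refine Finset.sum_congr rfl fun d hd => ?_
    have hd' : (2 : ℝ) ≤ d := by exact_mod_cast (Finset.mem_Icc.1 hd).1
    have : Real.log d ≠ 0 := (Real.log_pos (by linarith)).ne'
    split_ifs with hp
    · rw [ArithmeticFunction.vonMangoldt_apply_prime hp]
      field_simp
    · field_simp
      ring
  rw [e, Nat.cast_ofNat] at key
  have h5 := abs_le.1 (h₃ N hN)
  have h6 := abs_le.1 key
  rw [abs_le]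
  constructor <;> linarith [h5.1, h5.2, h6.1, h6.2]

/-! ### Approximate shift invariance -/

theorem sum_Icc_sum_divisorsAntidiagonal {M : Type*} [AddCommMonoid M] (F : ℕ → ℕ → M) (N : ℕ) :
    ∑ n ∈ Icc 1 N, ∑ x ∈ n.divisorsAntidiagonal, F x.1 x.2 =
      ∑ m ∈ Icc 1 N, ∑ d ∈ Icc 1 (N / m), F d m := by
  rw [Finset.sum_sigma', Finset.sum_sigma']
  refine Finset.sum_bij' (fun y _ => ⟨y.2.2, y.2.1⟩)
    (fun y _ => ⟨y.2 * y.1, (y.2, y.1)⟩) ?_ ?_ ?_ ?_ ?_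
  · rintro ⟨n, d, m⟩ h
    simp only [Finset.mem_sigma, Finset.mem_Icc, Nat.mem_divisorsAntidiagonal] at h ⊢
    obtain ⟨⟨h1, h2⟩, rfl, h3⟩ := h
    have hd : 0 < d := Nat.pos_of_ne_zero (by rintro rfl; simp at h3)
    have hm : 0 < m := Nat.pos_of_ne_zero (by rintro rfl; simp at h3)
    exact ⟨⟨hm, (Nat.le_mul_of_pos_left m hd).trans h2⟩, hd, (Nat.le_div_iff_mul_le hm).2 h2⟩
  · rintro ⟨m, d⟩ h
    simp only [Finset.mem_sigma, Finset.mem_Icc, Nat.mem_divisorsAntidiagonal] at h ⊢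
    obtain ⟨⟨h1, h2⟩, h3, h4⟩ := h
    have := (Nat.le_div_iff_mul_le h1).1 h4
    have h5 : 0 < d * m := Nat.mul_pos h3 h1
    exact ⟨⟨h5, this⟩, trivial, h5.ne'⟩
  · rintro ⟨n, d, m⟩ h
    simp only [Finset.mem_sigma, Nat.mem_divisorsAntidiagonal] at h
    obtain ⟨_, rfl, _⟩ := h
    rfl
  · rintro ⟨m, d⟩ _
    rfl
  · rintro ⟨n, d, m⟩ _
    rfl

theorem sum_vonMangoldt_div_mul_log_sq_le :
    ∃ C : ℝ, 0 ≤ C ∧ ∀ N : ℕ, ∑ d ∈ Icc 1 N, Λ d / (d * Real.log d ^ 2) ≤ C := by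
  obtain ⟨C₁, h₁⟩ := abs_sum_vonMangoldt_sub_one_div_le
  have hC₁ : 0 ≤ C₁ := (abs_nonneg _).trans (h₁ 0)
  have hl := Real.log_pos one_lt_two
  refine ⟨(C₁ + 1) * (1 / Real.log 2 ^ 2) + (1 / (2 * Real.log 2 ^ 2) + 1 / Real.log 2),
    by positivity, fun N => ?_⟩
  rcases lt_or_ge N 2 with hN | hN
  · refine le_trans (le_of_eq (Finset.sum_eq_zero fun d hd => ?_)) (by positivity)
    have : d = 1 := by have := Finset.mem_Icc.1 hd; omega
    simp [this]
  have hsplit : ∀ (M : ℕ) (f : ℕ → ℝ), 1 ≤ M →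
      ∑ i ∈ Icc 1 M, f i = f 1 + ∑ i ∈ Icc 2 M, f i := fun M f hM => by
    rw [← Finset.insert_Icc_add_one_left_eq_Icc hM, Finset.sum_insert (by simp)]
    rfl
  have key : |∑ d ∈ Icc 2 N, (Λ d - 1) / (d : ℝ) * (1 / Real.log d ^ 2)| ≤
      (C₁ + 1) * (1 / Real.log (2 : ℕ) ^ 2) := by
    refine abs_sum_mul_le_of_abs_partial_sums_le (w := fun d : ℕ => 1 / Real.log d ^ 2) hN ?_ ?_ ?_
    · intro m hm _
      have h4 := abs_le.1 (h₁ m)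
      rw [hsplit m _ (by omega)] at h4
      simp only [ArithmeticFunction.vonMangoldt_apply_one, Nat.cast_one] at h4
      rw [abs_le]
      constructor <;> linarith [h4.1, h4.2]
    · intro m hm _
      have hm' : (2 : ℝ) ≤ m := by exact_mod_cast hm
      have : 0 < Real.log m := Real.log_pos (by linarith)
      push_cast
      gcongr
      linarith
    · positivity
  rw [hsplit N _ (by omega)]
  have e : ∑ d ∈ Icc 2 N, Λ d / (d * Real.log d ^ 2) =
      ∑ d ∈ Icc 2 N, (Λ d - 1) / (d : ℝ) * (1 / Real.log d ^ 2) +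
        ∑ d ∈ Icc 2 N, 1 / ((d : ℝ) * Real.log d ^ 2) := by
    rw [← Finset.sum_add_distrib]
    refine Finset.sum_congr rfl fun d hd => ?_
    rw [div_mul_div_comm, ← add_div]
    ring
  rw [e]
  have h5 := (abs_le.1 key).2
  have h6 := sum_one_div_mul_log_sq_le N
  simp only [ArithmeticFunction.vonMangoldt_apply_one, Nat.cast_ofNat, zero_div, zero_add] at h5 ⊢
  linarith

theorem abs_sum_vonMangoldt_div_log_add_log_sq_sub_le :
    ∃ C : ℝ, 0 ≤ C ∧ ∀ N m : ℕ, 2 ≤ m → m ≤ N →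
      |∑ d ∈ Icc 1 (N / m), Λ d / d * (1 / (Real.log d + Real.log m) ^ 2) - 1 / Real.log m| ≤
        C / Real.log m ^ 2 + 1 / Real.log N := by
  obtain ⟨C₁, h₁⟩ := abs_sum_vonMangoldt_sub_one_div_le
  have hC₁ : 0 ≤ C₁ := (abs_nonneg _).trans (h₁ 0)
  refine ⟨C₁ + 1, by positivity, fun N m hm hmN => ?_⟩
  have hm' : (2 : ℝ) ≤ m := by exact_mod_cast hm
  have hN' : (m : ℝ) ≤ N := by exact_mod_cast hmN
  have ht : 0 < Real.log m := Real.log_pos (by linarith)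
  have hD : 1 ≤ N / m := (Nat.one_le_div_iff (by omega)).2 hmN
  have hD2 : N < (N / m + 1) * m := by
    rw [mul_comm]; exact Nat.lt_mul_div_succ N (by omega)
  have hlogD : Real.log N ≤ Real.log ((N / m : ℕ) + 1) + Real.log m := by
    rw [← Real.log_mul (by positivity) (by positivity)]
    exact Real.log_le_log (by linarith) (by exact_mod_cast hD2.le)
  generalize N / m = D at hD hlogD
  set t := Real.log m with htdef
  have key : |∑ d ∈ Icc 1 D, (Λ d - 1) / (d : ℝ) * (1 / (Real.log d + t) ^ 2)| ≤
      C₁ * (1 / (Real.log (1 : ℕ) + t) ^ 2) := by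
    refine abs_sum_mul_le_of_abs_partial_sums_le
      (w := fun d : ℕ => 1 / (Real.log d + t) ^ 2) hD (fun k _ _ => h₁ k) ?_ ?_
    · intro k hk _
      have hk' : (1 : ℝ) ≤ k := by exact_mod_cast hk
      have := Real.log_nonneg hk'
      push_cast
      gcongr
      linarith
    · positivity
  have main : ∀ D : ℕ, 1 ≤ D →
      1 / t - 1 / (Real.log (D + 1) + t) ≤
        ∑ d ∈ Icc 1 D, 1 / (d : ℝ) * (1 / (Real.log d + t) ^ 2) ∧
      ∑ d ∈ Icc 1 D, 1 / (d : ℝ) * (1 / (Real.log d + t) ^ 2) ≤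
        1 / t ^ 2 + (1 / t - 1 / (Real.log D + t)) := by
    intro D hD
    induction D, hD using Nat.le_induction with
    | base =>
      have := (one_div_log_sub_mem (d := 1) (t := t) le_rfl (by simpa using ht)).2
      simpa using this
    | succ D hD ih =>
      rw [← Finset.insert_Icc_right_eq_Icc_add_one (by omega), Finset.sum_insert (by simp)]
      have hD' : (1 : ℝ) ≤ D := by exact_mod_cast hD
      have h2 := (one_div_log_sub_mem (d := D) (t := t) hD
        (by have := Real.log_nonneg hD'; linarith)).1
      have h3 := (one_div_log_sub_mem (d := D + 1) (t := t) (by omega)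
        (by have := Real.log_natCast_nonneg (D + 1); linarith)).2
      push_cast at h2 h3 ⊢
      rw [one_div_mul_one_div]
      constructor <;> linarith [ih.1, ih.2]
  obtain ⟨m1, m2⟩ := main D hD
  have e : ∑ d ∈ Icc 1 D, Λ d / d * (1 / (Real.log d + t) ^ 2) =
      ∑ d ∈ Icc 1 D, (Λ d - 1) / (d : ℝ) * (1 / (Real.log d + t) ^ 2) +
        ∑ d ∈ Icc 1 D, 1 / (d : ℝ) * (1 / (Real.log d + t) ^ 2) := by
    rw [← Finset.sum_add_distrib]
    refine Finset.sum_congr rfl fun d _ => ?_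
    ring
  have hlogN : 0 < Real.log N := Real.log_pos (by linarith)
  have h4 : 1 / (Real.log (D + 1) + t) ≤ 1 / Real.log N := by gcongr
  have h5 : 0 ≤ 1 / (Real.log D + t) := by
    have := Real.log_natCast_nonneg D
    positivity
  have h6 : 0 ≤ 1 / Real.log N := by positivity
  have h7 : 0 ≤ 1 / t ^ 2 := by positivity
  simp only [Nat.cast_one, Real.log_one, zero_add] at key
  have h8 := abs_le.1 key
  rw [e, abs_le, add_div, div_eq_mul_one_div C₁]
  constructor <;> linarith [h8.1, h8.2]

theorem bigOmega_mul {m n : ℕ} (hm : m ≠ 0) (hn : n ≠ 0) :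
    bigOmega (m * n) = bigOmega m + bigOmega n :=
  ArithmeticFunction.cardFactors_mul hm hn

theorem bigOmega_prime {p : ℕ} (hp : p.Prime) : bigOmega p = 1 :=
  ArithmeticFunction.cardFactors_apply_prime hp

/-- The double-logarithmic weights `1 / (n log n)` see a shift of `Ω` only up to `O(1)`. -/
theorem norm_sum_bigOmega_sub_shift_le :
    ∃ C : ℝ, 0 ≤ C ∧ ∀ (N : ℕ) (f : ℕ → ℂ), (∀ n, ‖f n‖ ≤ 1) →
      ‖∑ n ∈ Icc 1 N, ((1 / (n * Real.log n) : ℝ) : ℂ) * f (bigOmega n) -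
        ∑ n ∈ Icc 1 N, ((1 / (n * Real.log n) : ℝ) : ℂ) * f (bigOmega n + 1)‖ ≤ C := by
  obtain ⟨C₁, hC₁, h₁⟩ := sum_vonMangoldt_div_mul_log_sq_le
  obtain ⟨C₂, hC₂, h₂⟩ := abs_sum_vonMangoldt_div_log_add_log_sq_sub_le
  obtain ⟨C₃, h₃⟩ := sum_vonMangoldt_nonprime_div_le
  have hC₃ : 0 ≤ C₃ := by simpa using h₃ 0
  have hl := Real.log_pos one_lt_two
  set B := 1 / (2 * Real.log 2 ^ 2) + 1 / Real.log 2 with hB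
  have hB0 : 0 ≤ B := by positivity
  refine ⟨C₁ + ((2 * C₃ + C₂) * B + (1 / Real.log 2 + 1)), by positivity, fun N f hf => ?_⟩
  set F : ℕ → ℕ → ℂ := fun d m =>
    ((Λ d / d * (1 / (m * (Real.log d + Real.log m) ^ 2)) : ℝ) : ℂ) * f (bigOmega d + bigOmega m)
    with hF
  have hexp : ∑ n ∈ Icc 1 N, ((1 / (n * Real.log n) : ℝ) : ℂ) * f (bigOmega n) =
      ∑ m ∈ Icc 1 N, ∑ d ∈ Icc 1 (N / m), F d m := by
    rw [← sum_Icc_sum_divisorsAntidiagonal]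
    refine Finset.sum_congr rfl fun n hn => ?_
    have e : ∀ x ∈ n.divisorsAntidiagonal, F x.1 x.2 =
        ((Λ x.1 * (1 / (n * Real.log n ^ 2)) : ℝ) : ℂ) * f (bigOmega n) := by
      rintro ⟨d, m⟩ hx
      obtain ⟨rfl, h0⟩ := Nat.mem_divisorsAntidiagonal.1 hx
      have hd : d ≠ 0 := left_ne_zero_of_mul h0
      have hm : m ≠ 0 := right_ne_zero_of_mul h0
      simp only [hF]
      rw [bigOmega_mul hd hm, Nat.cast_mul, Real.log_mul (by positivity) (by positivity),
        div_mul_div_comm, mul_one_div, mul_one, mul_assoc]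
    rw [Finset.sum_congr rfl e, ← Finset.sum_mul, ← Complex.ofReal_sum, ← Finset.sum_mul,
      Nat.sum_divisorsAntidiagonal (fun d _ => Λ d) (n := n),
      ArithmeticFunction.vonMangoldt_sum]
    congr 2
    rcases eq_or_ne (Real.log n) 0 with h | h
    · simp [h]
    · field_simp
  rw [hexp, ← Finset.sum_sub_distrib]
  refine (norm_sum_le _ _).trans ?_
  have hone : ‖∑ d ∈ Icc 1 (N / 1), F d 1‖ ≤ C₁ := by
    refine (norm_sum_le _ _).trans (le_trans ?_ (h₁ (N / 1)))
    refine Finset.sum_le_sum fun d _ => ?_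
    simp only [hF]
    rw [norm_mul, Complex.norm_real]
    refine (mul_le_of_le_one_right (norm_nonneg (_ : ℝ)) (hf _)).trans (le_of_eq ?_)
    have := ArithmeticFunction.vonMangoldt_nonneg (n := d)
    rw [Real.norm_of_nonneg (by positivity)]
    simp [div_eq_mul_inv, mul_assoc, mul_comm, mul_left_comm]
  have hterm : ∀ m ∈ Icc 2 N,
      ‖∑ d ∈ Icc 1 (N / m), F d m - ((1 / (m * Real.log m) : ℝ) : ℂ) * f (bigOmega m + 1)‖ ≤
        (2 * C₃ + C₂) * (1 / (m * Real.log m ^ 2)) + 1 / m * (1 / Real.log N) := by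
    intro m hm
    obtain ⟨hm, hmN⟩ := Finset.mem_Icc.1 hm
    have hm' : (2 : ℝ) ≤ m := by exact_mod_cast hm
    have ht : 0 < Real.log m := Real.log_pos (by linarith)
    have hK := h₂ N m hm hmN
    set K := ∑ d ∈ Icc 1 (N / m), Λ d / d * (1 / (Real.log d + Real.log m) ^ 2) with hKdef
    have e : ∑ d ∈ Icc 1 (N / m), F d m - ((1 / (m * Real.log m) : ℝ) : ℂ) * f (bigOmega m + 1) =
        ∑ d ∈ Icc 1 (N / m), ((Λ d / d * (1 / (m * (Real.log d + Real.log m) ^ 2)) : ℝ) : ℂ) *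
          (f (bigOmega d + bigOmega m) - f (bigOmega m + 1)) +
        ((1 / m * (K - 1 / Real.log m) : ℝ) : ℂ) * f (bigOmega m + 1) := by
      simp only [mul_sub, Finset.sum_sub_distrib, hF]
      rw [← Finset.sum_mul, ← Complex.ofReal_sum, Complex.ofReal_sub, sub_mul]
      have e1 : ∑ d ∈ Icc 1 (N / m), Λ d / d * (1 / (m * (Real.log d + Real.log m) ^ 2)) =
          1 / m * K := by
        rw [hKdef, Finset.mul_sum]
        refine Finset.sum_congr rfl fun d _ => ?_
        rw [← one_div_mul_one_div]
        ring
      rw [e1, one_div_mul_one_div]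
      ring
    rw [e]
    refine (norm_add_le _ _).trans ?_
    have b1 : ‖∑ d ∈ Icc 1 (N / m),
        ((Λ d / d * (1 / (m * (Real.log d + Real.log m) ^ 2)) : ℝ) : ℂ) *
          (f (bigOmega d + bigOmega m) - f (bigOmega m + 1))‖ ≤
        C₃ * (2 * (1 / (m * Real.log m ^ 2))) := by
      refine (norm_sum_le _ _).trans ?_
      refine le_trans ?_ (mul_le_mul_of_nonneg_right (h₃ (N / m)) (by positivity))
      rw [Finset.sum_mul]
      refine Finset.sum_le_sum fun d hd => ?_
      have hd' : (1 : ℝ) ≤ d := by exact_mod_cast (Finset.mem_Icc.1 hd).1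
      have hlog := Real.log_nonneg hd'
      have hL := ArithmeticFunction.vonMangoldt_nonneg (n := d)
      split_ifs with hp
      · rw [bigOmega_prime hp, add_comm 1, sub_self, mul_zero, norm_zero]
        positivity
      · rw [norm_mul, Complex.norm_real, Real.norm_of_nonneg (by positivity), mul_assoc,
          mul_comm 2]
        gcongr
        · linarith
        · refine (norm_sub_le _ _).trans ?_
          linarith [hf (bigOmega d + bigOmega m), hf (bigOmega m + 1)]
    have b2 : ‖((1 / m * (K - 1 / Real.log m) : ℝ) : ℂ) * f (bigOmega m + 1)‖ ≤
        1 / m * (C₂ / Real.log m ^ 2 + 1 / Real.log N) := by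
      rw [norm_mul, Complex.norm_real, Real.norm_eq_abs, abs_mul, abs_of_nonneg (by positivity)]
      exact (mul_le_of_le_one_right (by positivity) (hf _)).trans
        (mul_le_mul_of_nonneg_left hK (by positivity))
    refine (add_le_add b1 b2).trans (le_of_eq ?_)
    rw [← one_div_mul_one_div, div_eq_mul_one_div C₂]
    ring
  rcases lt_or_ge N 2 with hN | hN
  · rcases Nat.lt_or_ge N 1 with h0 | h0
    · rw [Finset.Icc_eq_empty (by omega), Finset.sum_empty]; positivity
    · obtain rfl : N = 1 := by omega
      simp only [Finset.Icc_self, Finset.sum_singleton] at hone ⊢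
      simp only [Nat.cast_one, Real.log_one, mul_zero, div_zero, Complex.ofReal_zero, zero_mul,
        sub_zero]
      refine hone.trans (le_add_of_nonneg_right (by positivity))
  rw [← Finset.insert_Icc_add_one_left_eq_Icc (by omega : 1 ≤ N), Finset.sum_insert (by simp)]
  refine add_le_add ?_ ((Finset.sum_le_sum hterm).trans ?_)
  · simpa using hone
  · rw [Finset.sum_add_distrib, ← Finset.mul_sum, ← Finset.sum_mul]
    have hN' : (2 : ℝ) ≤ N := by exact_mod_cast hN
    have hlogN : Real.log 2 ≤ Real.log N := Real.log_le_log (by norm_num) hN'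
    have hlogN0 : 0 < Real.log N := hl.trans_le hlogN
    refine add_le_add (mul_le_mul_of_nonneg_left (sum_one_div_mul_log_sq_le N) (by positivity)) ?_
    have h5 : ∑ n ∈ Icc 2 N, 1 / (n : ℝ) ≤ 1 + Real.log N := by
      have h6 := (abs_le.1 (abs_sum_one_div_sub_log_le (N := N) (by omega))).2
      have h7 : ∑ n ∈ Icc 2 N, 1 / (n : ℝ) ≤ ∑ n ∈ Icc 1 N, 1 / (n : ℝ) :=
        Finset.sum_le_sum_of_subset_of_nonneg (Finset.Icc_subset_Icc_left (by norm_num))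
          fun _ _ _ => by positivity
      linarith
    refine (mul_le_mul_of_nonneg_right h5 (by positivity)).trans ?_
    rw [add_mul, mul_one_div_cancel hlogN0.ne', one_mul]
    gcongr

/-! ### Concentration of `Ω` -/

theorem smallOmega_eq_sum {n N : ℕ} (hn : 1 ≤ n) (hnN : n ≤ N) :
    (smallOmega n : ℝ) = ∑ p ∈ Icc 1 N with p.Prime, if p ∣ n then 1 else 0 := by
  rw [Finset.sum_boole, Finset.filter_filter, smallOmega]
  congr 2
  ext p
  simp only [Nat.mem_primeFactors, Finset.mem_filter, Finset.mem_Icc]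
  constructor
  · rintro ⟨hp, hd, _⟩
    exact ⟨⟨hp.one_lt.le, (Nat.le_of_dvd hn hd).trans hnN⟩, hp, hd⟩
  · rintro ⟨_, hp, hd⟩
    exact ⟨hp, hd, by omega⟩

theorem sum_Icc_ite_dvd (N d : ℕ) :
    ∑ n ∈ Icc 1 N, (if d ∣ n then (1 : ℝ) else 0) = ((N / d : ℕ) : ℝ) := by
  rw [Finset.sum_boole, ← Nat.Ioc_filter_dvd_card_eq_div N d]
  rfl

theorem card_filter_prime_Icc_le (N : ℕ) : #{p ∈ Icc 1 N | p.Prime} ≤ N :=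
  (Finset.card_filter_le _ _).trans (by simp)

theorem le_sum_smallOmega (N : ℕ) :
    N * ∑ p ∈ Icc 1 N with p.Prime, 1 / (p : ℝ) - N ≤ ∑ n ∈ Icc 1 N, (smallOmega n : ℝ) := by
  rw [Finset.sum_congr rfl fun n hn =>
    smallOmega_eq_sum (Finset.mem_Icc.1 hn).1 (Finset.mem_Icc.1 hn).2, Finset.sum_comm]
  simp only [sum_Icc_ite_dvd]
  have h : (#{p ∈ Icc 1 N | p.Prime} : ℝ) ≤ N := by exact_mod_cast card_filter_prime_Icc_le N
  refine (sub_le_sub_left h _).trans ?_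
  rw [Finset.mul_sum, Finset.card_eq_sum_ones, Nat.cast_sum, ← Finset.sum_sub_distrib]
  refine Finset.sum_le_sum fun p _ => ?_
  have := Nat.lt_floor_add_one ((N : ℝ) / p)
  rw [Nat.floor_div_natCast, Nat.floor_natCast] at this
  push_cast
  rw [mul_one_div]
  linarith

theorem sum_smallOmega_sq_le (N : ℕ) :
    ∑ n ∈ Icc 1 N, (smallOmega n : ℝ) ^ 2 ≤
      N * (∑ p ∈ Icc 1 N with p.Prime, 1 / (p : ℝ)) ^ 2 +
        N * ∑ p ∈ Icc 1 N with p.Prime, 1 / (p : ℝ) := by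
  have e : ∑ n ∈ Icc 1 N, (smallOmega n : ℝ) ^ 2 =
      ∑ p ∈ Icc 1 N with p.Prime, ∑ q ∈ Icc 1 N with q.Prime,
        ∑ n ∈ Icc 1 N, (if p ∣ n then (1 : ℝ) else 0) * (if q ∣ n then 1 else 0) := by
    rw [Finset.sum_congr rfl fun p _ => Finset.sum_comm, Finset.sum_comm]
    refine Finset.sum_congr rfl fun n hn => ?_
    rw [smallOmega_eq_sum (Finset.mem_Icc.1 hn).1 (Finset.mem_Icc.1 hn).2, sq,
      Finset.sum_mul_sum]
  rw [e, sq, Finset.sum_mul_sum, Finset.mul_sum, Finset.mul_sum, ← Finset.sum_add_distrib]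
  refine Finset.sum_le_sum fun p hp => ?_
  have hp' := (Finset.mem_filter.1 hp).2
  have e2 : (N : ℝ) * (1 / (p : ℝ)) =
      ∑ q ∈ Icc 1 N with q.Prime, if p = q then (N : ℝ) * (1 / (p : ℝ)) else 0 := by
    rw [Finset.sum_ite_eq, if_pos hp]
  rw [e2, Finset.mul_sum, ← Finset.sum_add_distrib]
  refine Finset.sum_le_sum fun q hq => ?_
  have hq' := (Finset.mem_filter.1 hq).2
  simp only [← ite_and, mul_boole]
  split_ifs with hpq
  · subst hpq
    simp only [and_self, sum_Icc_ite_dvd]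
    have : ((N / p : ℕ) : ℝ) ≤ N / p := Nat.cast_div_le
    have h0 : 0 ≤ (N : ℝ) * (1 / p * (1 / p)) := by positivity
    rw [mul_one_div (N : ℝ) (p : ℝ)]
    linarith
  · have hc := (Nat.coprime_primes hp' hq').2 hpq
    have : ∀ n : ℕ, (q ∣ n ∧ p ∣ n) ↔ p * q ∣ n := fun n =>
      ⟨fun h => hc.mul_dvd_of_dvd_of_dvd h.2 h.1,
        fun h => ⟨(Nat.dvd_mul_left q p).trans h, (Nat.dvd_mul_right p q).trans h⟩⟩
    simp only [this, sum_Icc_ite_dvd]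
    have h1 : ((N / (p * q) : ℕ) : ℝ) ≤ N / (p * q : ℕ) := Nat.cast_div_le
    rw [one_div_mul_one_div, mul_one_div, add_zero]
    exact_mod_cast h1

/-- Turán's inequality, in mean. -/
theorem sum_abs_smallOmega_sub_le (N : ℕ) :
    ∑ n ∈ Icc 1 N, |(smallOmega n : ℝ) - ∑ p ∈ Icc 1 N with p.Prime, 1 / (p : ℝ)| ≤
      2 * N * √(∑ p ∈ Icc 1 N with p.Prime, 1 / (p : ℝ) + 1) := by
  have h1 := le_sum_smallOmega N
  have h2 := sum_smallOmega_sq_le N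
  have hP : 0 ≤ ∑ p ∈ Icc 1 N with p.Prime, 1 / (p : ℝ) :=
    Finset.sum_nonneg fun _ _ => by positivity
  set P := ∑ p ∈ Icc 1 N with p.Prime, 1 / (p : ℝ)
  set s := √(P + 1)
  have hs : s ^ 2 = P + 1 := Real.sq_sqrt (by linarith)
  have hs0 : 0 < s := Real.sqrt_pos.2 (by linarith)
  have hvar : ∑ n ∈ Icc 1 N, ((smallOmega n : ℝ) - P) ^ 2 ≤ 3 * N * P := by
    have e : ∑ n ∈ Icc 1 N, ((smallOmega n : ℝ) - P) ^ 2 =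
        ∑ n ∈ Icc 1 N, (smallOmega n : ℝ) ^ 2 - 2 * P * ∑ n ∈ Icc 1 N, (smallOmega n : ℝ) +
          N * P ^ 2 := by
      simp only [sub_sq, Finset.sum_add_distrib, Finset.sum_sub_distrib, Finset.mul_sum]
      congr 1
      · congr 1
        exact Finset.sum_congr rfl fun n _ => by ring
      · simp
    rw [e]
    nlinarith [mul_le_mul_of_nonneg_left h1 hP]
  have hN : (0 : ℝ) ≤ N := Nat.cast_nonneg N
  have h3 : 2 * s * ∑ n ∈ Icc 1 N, |(smallOmega n : ℝ) - P| ≤ 3 * N * P + N * s ^ 2 := by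
    refine le_trans ?_ (add_le_add_left hvar _)
    have : (N : ℝ) * s ^ 2 = ∑ n ∈ Icc 1 N, s ^ 2 := by simp
    rw [this, ← Finset.sum_add_distrib, Finset.mul_sum]
    refine Finset.sum_le_sum fun n _ => ?_
    rw [← sq_abs ((smallOmega n : ℝ) - P)]
    nlinarith [sq_nonneg (|(smallOmega n : ℝ) - P| - s)]
  refine le_of_mul_le_mul_left ?_ (by positivity : 0 < 2 * s)
  nlinarith

theorem bigOmega_sub_smallOmega_mul_log_two_le {n : ℕ} (hn : n ≠ 0) :
    ((bigOmega n : ℝ) - smallOmega n) * Real.log 2 ≤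
      ∑ d ∈ n.divisors, if d.Prime then 0 else Λ d := by
  have e1 : (bigOmega n : ℝ) = ∑ p ∈ n.primeFactors, (n.factorization p : ℝ) := by
    have : bigOmega n = ∑ p ∈ n.primeFactors, n.factorization p :=
      ArithmeticFunction.cardFactors_eq_sum_factorization
    rw [this, Nat.cast_sum]
  have e2 : (smallOmega n : ℝ) = ∑ p ∈ n.primeFactors, (1 : ℝ) := by simp [smallOmega]
  have e3 : ∑ d ∈ n.divisors, (if d.Prime then 0 else Λ d) =
      Real.log n - ∑ p ∈ n.primeFactors, Real.log p := by
    have h : n.primeFactors = {d ∈ n.divisors | d.Prime} := by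
      ext p
      simp only [Nat.mem_primeFactors, Finset.mem_filter, Nat.mem_divisors]
      tauto
    rw [← ArithmeticFunction.vonMangoldt_sum, h, Finset.sum_filter, ← Finset.sum_sub_distrib]
    refine Finset.sum_congr rfl fun d _ => ?_
    split_ifs with hd
    · rw [ArithmeticFunction.vonMangoldt_apply_prime hd, sub_self]
    · rw [sub_zero]
  rw [e3, Real.log_nat_eq_sum_factorization, e1, e2, Finsupp.sum, Nat.support_factorization,
    ← Finset.sum_sub_distrib, ← Finset.sum_sub_distrib, Finset.sum_mul]
  refine Finset.sum_le_sum fun p hp => ?_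
  have hp' := Nat.prime_of_mem_primeFactors hp
  have h1 : (1 : ℝ) ≤ n.factorization p := by
    exact_mod_cast hp'.factorization_pos_of_dvd hn (Nat.dvd_of_mem_primeFactors hp)
  have h2 : Real.log 2 ≤ Real.log p :=
    Real.log_le_log (by norm_num) (by exact_mod_cast hp'.two_le)
  nlinarith

theorem smallOmega_le_bigOmega (n : ℕ) : smallOmega n ≤ bigOmega n :=
  Multiset.toFinset_card_le (n.primeFactorsList : Multiset ℕ)

theorem sum_bigOmega_sub_smallOmega_le :
    ∃ C : ℝ, 0 ≤ C ∧ ∀ N : ℕ, ∑ n ∈ Icc 1 N, ((bigOmega n : ℝ) - smallOmega n) ≤ C * N := by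
  obtain ⟨C, h⟩ := sum_vonMangoldt_nonprime_div_le
  have hC : 0 ≤ C := by simpa using h 0
  have hl := Real.log_pos one_lt_two
  refine ⟨C / Real.log 2, by positivity, fun N => ?_⟩
  rw [div_mul_eq_mul_div, le_div_iff₀ hl, Finset.sum_mul]
  calc ∑ n ∈ Icc 1 N, ((bigOmega n : ℝ) - smallOmega n) * Real.log 2
      ≤ ∑ n ∈ Icc 1 N, ∑ d ∈ n.divisors, if d.Prime then 0 else Λ d :=
        Finset.sum_le_sum fun n hn => bigOmega_sub_smallOmega_mul_log_two_le
          (by have := (Finset.mem_Icc.1 hn).1; omega)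
    _ = ∑ n ∈ Icc 1 N, ∑ x ∈ n.divisorsAntidiagonal, if x.2.Prime then 0 else Λ x.2 :=
        Finset.sum_congr rfl fun n _ =>
          (Nat.sum_divisorsAntidiagonal' (fun _ d => if d.Prime then 0 else Λ d)).symm
    _ = ∑ m ∈ Icc 1 N, ∑ d ∈ Icc 1 (N / m), if m.Prime then 0 else Λ m :=
        sum_Icc_sum_divisorsAntidiagonal (fun _ m => if m.Prime then 0 else Λ m) N
    _ ≤ ∑ m ∈ Icc 1 N, (if m.Prime then 0 else Λ m) / (m : ℝ) * N := by
        refine Finset.sum_le_sum fun m _ => ?_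
        rw [Finset.sum_const, Nat.card_Icc, Nat.add_sub_cancel, nsmul_eq_mul, div_mul_eq_mul_div,
          mul_comm, ← mul_div_assoc']
        refine mul_le_mul_of_nonneg_left Nat.cast_div_le ?_
        have := ArithmeticFunction.vonMangoldt_nonneg (n := m)
        split_ifs <;> positivity
    _ ≤ C * N := by
        rw [← Finset.sum_mul]
        exact mul_le_mul_of_nonneg_right (h N) (by positivity)

theorem sum_prime_one_div_sub_le (N : ℕ) :
    ∑ n ∈ Icc 1 N, (∑ p ∈ Icc 1 N with p.Prime, 1 / (p : ℝ) -
      ∑ p ∈ Icc 1 n with p.Prime, 1 / (p : ℝ)) ≤ N := by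
  have e : ∀ n ∈ Icc 1 N, ∑ p ∈ Icc 1 N with p.Prime, 1 / (p : ℝ) -
      ∑ p ∈ Icc 1 n with p.Prime, 1 / (p : ℝ) =
      ∑ p ∈ Icc 1 N with p.Prime, if n < p then 1 / (p : ℝ) else 0 := by
    intro n hn
    have hn' := Finset.mem_Icc.1 hn
    rw [sub_eq_iff_eq_add, ← Finset.sum_filter_add_sum_filter_not {p ∈ Icc 1 N | p.Prime}
      (fun p => n < p), Finset.sum_filter (fun p => n < p)]
    congr 2
    ext p
    simp only [Finset.mem_filter, Finset.mem_Icc]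
    constructor
    · rintro ⟨⟨⟨h1, h2⟩, h3⟩, h4⟩; exact ⟨⟨h1, by omega⟩, h3⟩
    · rintro ⟨⟨h1, h2⟩, h3⟩; exact ⟨⟨⟨h1, by omega⟩, h3⟩, by omega⟩
  rw [Finset.sum_congr rfl e, Finset.sum_comm]
  have h : (#{p ∈ Icc 1 N | p.Prime} : ℝ) ≤ N := by exact_mod_cast card_filter_prime_Icc_le N
  refine le_trans ?_ h
  rw [Finset.card_eq_sum_ones, Nat.cast_sum]
  refine Finset.sum_le_sum fun p hp => ?_
  have hp' : (0 : ℝ) < p := by exact_mod_cast (Finset.mem_filter.1 hp).2.pos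
  rw [← Finset.sum_filter, Finset.sum_const, nsmul_eq_mul, mul_one_div, Nat.cast_one,
    div_le_one hp', Nat.cast_le]
  calc #{n ∈ Icc 1 N | n < p} ≤ #(Finset.Ico 1 p) := Finset.card_le_card fun n hn => by
        simp only [Finset.mem_filter, Finset.mem_Icc] at hn
        exact Finset.mem_Ico.2 ⟨hn.1.1, hn.2⟩
    _ ≤ p := by simp

theorem sum_abs_bigOmega_sub_le :
    ∃ C : ℝ, 0 ≤ C ∧ ∀ N : ℕ,
      ∑ n ∈ Icc 1 N, |(bigOmega n : ℝ) - ∑ p ∈ Icc 1 n with p.Prime, 1 / (p : ℝ)| ≤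
        (C + 2 * √(∑ p ∈ Icc 1 N with p.Prime, 1 / (p : ℝ) + 1)) * N := by
  obtain ⟨C, hC, h1⟩ := sum_bigOmega_sub_smallOmega_le
  refine ⟨C + 1, by positivity, fun N => ?_⟩
  have h2 := sum_abs_smallOmega_sub_le N
  have h3 := sum_prime_one_div_sub_le N
  have h4 : ∑ n ∈ Icc 1 N, |(bigOmega n : ℝ) - ∑ p ∈ Icc 1 n with p.Prime, 1 / (p : ℝ)| ≤
      ∑ n ∈ Icc 1 N, ((bigOmega n : ℝ) - smallOmega n) +
      ∑ n ∈ Icc 1 N, |(smallOmega n : ℝ) - ∑ p ∈ Icc 1 N with p.Prime, 1 / (p : ℝ)| +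
      ∑ n ∈ Icc 1 N, (∑ p ∈ Icc 1 N with p.Prime, 1 / (p : ℝ) -
        ∑ p ∈ Icc 1 n with p.Prime, 1 / (p : ℝ)) := by
    rw [← Finset.sum_add_distrib, ← Finset.sum_add_distrib]
    refine Finset.sum_le_sum fun n hn => ?_
    have h5 : (smallOmega n : ℝ) ≤ bigOmega n := by exact_mod_cast smallOmega_le_bigOmega n
    have h6 : ∑ p ∈ Icc 1 n with p.Prime, 1 / (p : ℝ) ≤
        ∑ p ∈ Icc 1 N with p.Prime, 1 / (p : ℝ) :=
      Finset.sum_le_sum_of_subset_of_nonneg (Finset.filter_subset_filter _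
        (Finset.Icc_subset_Icc_right (Finset.mem_Icc.1 hn).2)) fun _ _ _ => by positivity
    generalize ∑ p ∈ Icc 1 n with p.Prime, 1 / (p : ℝ) = a at h6 ⊢
    generalize ∑ p ∈ Icc 1 N with p.Prime, 1 / (p : ℝ) = b at h6 ⊢
    have h7 := le_abs_self ((smallOmega n : ℝ) - b)
    have h8 := neg_abs_le ((smallOmega n : ℝ) - b)
    rw [abs_le]
    constructor <;> linarith
  nlinarith [h1 N]

/-! ### The double logarithm as a weight -/

/-- `log log n`, truncated to `0` for `n ≤ 2`. -/
noncomputable def logLog (n : ℕ) : ℝ := if n ≤ 2 then 0 else Real.log (Real.log n)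

theorem logLog_of_le_two {n : ℕ} (hn : n ≤ 2) : logLog n = 0 := if_pos hn

theorem logLog_of_two_lt {n : ℕ} (hn : 2 < n) : logLog n = Real.log (Real.log n) :=
  if_neg (by omega)

theorem one_le_log_three : 1 ≤ Real.log 3 := by
  rw [Real.le_log_iff_exp_le (by norm_num)]
  exact (Real.exp_one_lt_d9.trans (by norm_num)).le

theorem log_log_three_mem : Real.log (Real.log 3) ∈ Set.Icc (0 : ℝ) 1 := by
  have h := one_le_log_three
  refine ⟨Real.log_nonneg h, ?_⟩
  have h1 := Real.log_le_sub_one_of_pos (by linarith : 0 < Real.log 3)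
  have h2 := Real.log_le_sub_one_of_pos (by norm_num : (0 : ℝ) < 3 / 2)
  have h3 := Real.log_two_lt_d9
  have h4 : Real.log 3 = Real.log (3 / 2) + Real.log 2 := by
    rw [← Real.log_mul (by norm_num) (by norm_num)]
    norm_num
  linarith

theorem logLog_succ_sub_mem (n : ℕ) : logLog (n + 1) - logLog n ∈ Set.Icc (0 : ℝ) 1 := by
  rcases lt_trichotomy n 2 with hn | rfl | hn
  · rw [logLog_of_le_two (by omega), logLog_of_le_two (by omega)]
    simp
  · rw [logLog_of_le_two le_rfl, logLog_of_two_lt (by norm_num), sub_zero]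
    exact_mod_cast log_log_three_mem
  · rw [logLog_of_two_lt hn, logLog_of_two_lt (by omega)]
    have h := log_log_sub_mem hn.le
    have h3 : (3 : ℝ) ≤ n := by exact_mod_cast hn
    have hl : 1 ≤ Real.log n := one_le_log_three.trans (Real.log_le_log (by norm_num) h3)
    have hl' : 0 ≤ Real.log (n + 1) := Real.log_nonneg (by linarith)
    push_cast
    refine ⟨le_trans (by positivity) h.1, h.2.trans ?_⟩
    rw [div_le_one (by positivity)]
    nlinarith

theorem logLog_mono : Monotone logLog :=
  monotone_nat_of_le_succ fun n => by linarith [(logLog_succ_sub_mem n).1]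

theorem logLog_nonneg (n : ℕ) : 0 ≤ logLog n := by
  simpa [logLog_of_le_two] using logLog_mono (Nat.zero_le n)

theorem dd_logLog_succ (n : ℕ) : dd logLog (n + 1) = logLog (n + 1) - logLog n := by
  rcases n with _ | n
  · simp [dd, logLog_of_le_two]
  · simp [dd]

theorem abs_logLog_sub_log_log_le {n : ℕ} (hn : 2 ≤ n) :
    |logLog n - Real.log (Real.log n)| ≤ |Real.log (Real.log 2)| := by
  rcases hn.eq_or_lt with rfl | hn
  · simp [logLog_of_le_two]
  · simp [logLog_of_two_lt hn]

theorem sum_Icc_one_div_mul_log_mul (g : ℕ → ℝ) (N : ℕ) :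
    ∑ n ∈ Icc 1 N, 1 / ((n : ℝ) * Real.log n) * g n =
      ∑ n ∈ Icc 2 N, g n * (1 / ((n : ℝ) * Real.log n)) := by
  simp only [mul_comm (g _)]
  refine (Finset.sum_subset (Finset.Icc_subset_Icc_left (by norm_num)) fun n h1 h2 => ?_).symm
  obtain rfl : n = 1 := by
    simp only [Finset.mem_Icc] at h1 h2
    omega
  simp

theorem sum_one_div_mul_log_le :
    ∃ C : ℝ, 0 ≤ C ∧ ∀ N : ℕ, ∑ n ∈ Icc 1 N, 1 / ((n : ℝ) * Real.log n) ≤ logLog N + C := by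
  obtain ⟨C, h⟩ := abs_sum_one_div_mul_log_sub_log_log_le
  have hC : 0 ≤ C := (abs_nonneg _).trans (h 2 le_rfl)
  refine ⟨C + |Real.log (Real.log 2)|, by positivity, fun N => ?_⟩
  have e := sum_Icc_one_div_mul_log_mul (fun _ => 1) N
  simp only [mul_one, one_mul] at e
  rw [e]
  rcases lt_or_ge N 2 with hN | hN
  · rw [Finset.Icc_eq_empty (by omega), Finset.sum_empty]
    have := logLog_nonneg N
    positivity
  · have h1 := abs_le.1 (h N hN)
    have h2 := abs_le.1 (abs_logLog_sub_log_log_le hN)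
    linarith [h1.2, h2.1]

theorem abs_sum_prime_one_div_sub_logLog_le :
    ∃ C : ℝ, 0 ≤ C ∧ ∀ N : ℕ, 2 ≤ N →
      |∑ p ∈ Icc 1 N with p.Prime, 1 / (p : ℝ) - logLog N| ≤ C := by
  obtain ⟨C, h⟩ := abs_sum_prime_one_div_sub_log_log_le
  have hC : 0 ≤ C := (abs_nonneg _).trans (h 2 le_rfl)
  refine ⟨C + |Real.log (Real.log 2)|, by positivity, fun N hN => ?_⟩
  have h1 := abs_le.1 (h N hN)
  have h2 := abs_le.1 (abs_logLog_sub_log_log_le hN)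
  rw [abs_le]
  constructor <;> linarith [h1.1, h1.2, h2.1, h2.2]

theorem one_div_mul_log_nonneg (n : ℕ) : 0 ≤ 1 / ((n : ℝ) * Real.log n) := by
  have := Real.log_natCast_nonneg n
  positivity

theorem one_div_mul_log_antitone {m : ℕ} (hm : 2 ≤ m) :
    1 / (((m + 1 : ℕ) : ℝ) * Real.log (m + 1 : ℕ)) ≤ 1 / ((m : ℝ) * Real.log m) := by
  have h2 : (2 : ℝ) ≤ m := by exact_mod_cast hm
  have hl : 0 < Real.log m := Real.log_pos (by linarith)
  have hle : Real.log m ≤ Real.log (m + 1 : ℕ) :=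
    Real.log_le_log (by linarith) (by push_cast; linarith)
  refine one_div_le_one_div_of_le (by positivity) ?_
  exact mul_le_mul (by push_cast; linarith) hle hl.le (by positivity)

/-- Concentration of `Ω(n)` around `log log n`, in the double-logarithmic mean. -/
theorem sum_one_div_mul_log_mul_abs_bigOmega_sub_le :
    ∃ C : ℝ, 0 ≤ C ∧ ∀ N : ℕ, 1 ≤ logLog N →
      ∑ n ∈ Icc 1 N, 1 / ((n : ℝ) * Real.log n) * |(bigOmega n : ℝ) - logLog n| ≤
        C * (logLog N * √(logLog N)) := by
  obtain ⟨C₁, hC₁, h₁⟩ := sum_abs_bigOmega_sub_le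
  obtain ⟨C₂, hC₂, h₂⟩ := sum_one_div_mul_log_le
  obtain ⟨D, hD, hP⟩ := abs_sum_prime_one_div_sub_logLog_le
  set c₂ : ℝ := 1 / ((2 : ℕ) * Real.log (2 : ℕ)) with hc₂
  have hc₂0 : 0 ≤ c₂ := one_div_mul_log_nonneg 2
  refine ⟨(C₁ + 2 * √(D + 2)) * (c₂ + 1 + C₂) + D * (1 + C₂), by positivity, fun N hN => ?_⟩
  have hN2 : 2 ≤ N := by
    by_contra! h
    rw [logLog_of_le_two h.le] at hN
    linarith
  set L := logLog N
  have hs : 1 ≤ √L := Real.one_le_sqrt.2 hN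
  set P : ℕ → ℝ := fun n => ∑ p ∈ Icc 1 n with p.Prime, 1 / (p : ℝ) with hPdef
  have hPmono : Monotone P := fun a b hab =>
    Finset.sum_le_sum_of_subset_of_nonneg (Finset.filter_subset_filter _
      (Finset.Icc_subset_Icc_right hab)) fun _ _ _ => by positivity
  set B := C₁ + 2 * √(P N + 1) with hB
  have hB0 : 0 ≤ B := by positivity
  have hBle : B ≤ (C₁ + 2 * √(D + 2)) * √L := by
    have hle : P N + 1 ≤ (D + 2) * L := by
      have := (abs_le.1 (hP N hN2)).2
      simp only [hPdef]
      nlinarith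
    have := Real.sqrt_le_sqrt hle
    rw [Real.sqrt_mul (by positivity)] at this
    nlinarith
  have hsum : ∑ n ∈ Icc 1 N, 1 / ((n : ℝ) * Real.log n) ≤ (1 + C₂) * L := by nlinarith [h₂ N]
  have habel : ∑ n ∈ Icc 2 N, (|(bigOmega n : ℝ) - P n| - B) * (1 / ((n : ℝ) * Real.log n)) ≤
      B * c₂ := by
    refine sum_mul_le_of_partial_sums_le (w := fun n : ℕ => 1 / ((n : ℝ) * Real.log n)) hN2
      (fun m hm hmN => ?_) (fun m hm _ => one_div_mul_log_antitone hm) (one_div_mul_log_nonneg N)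
    have h3 : ∑ n ∈ Icc 2 m, |(bigOmega n : ℝ) - P n| ≤ B * m := by
      calc ∑ n ∈ Icc 2 m, |(bigOmega n : ℝ) - P n|
          ≤ ∑ n ∈ Icc 1 m, |(bigOmega n : ℝ) - P n| :=
            Finset.sum_le_sum_of_subset_of_nonneg (Finset.Icc_subset_Icc_left (by norm_num))
              fun _ _ _ => abs_nonneg _
        _ ≤ (C₁ + 2 * √(P m + 1)) * m := h₁ m
        _ ≤ B * m := by
            have := hPmono hmN
            rw [hB]
            gcongr
    have h4 : ((m + 1 - 2 : ℕ) : ℝ) = m - 1 := by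
      rw [Nat.cast_sub (by omega)]
      push_cast
      ring
    rw [Finset.sum_sub_distrib, Finset.sum_const, Nat.card_Icc, nsmul_eq_mul, h4]
    linarith
  have hmain : ∑ n ∈ Icc 1 N, 1 / ((n : ℝ) * Real.log n) * |(bigOmega n : ℝ) - P n| ≤
      B * c₂ + B * ∑ n ∈ Icc 1 N, 1 / ((n : ℝ) * Real.log n) := by
    have e : ∑ n ∈ Icc 1 N, 1 / ((n : ℝ) * Real.log n) * |(bigOmega n : ℝ) - P n| =
        ∑ n ∈ Icc 1 N, 1 / ((n : ℝ) * Real.log n) * (|(bigOmega n : ℝ) - P n| - B) +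
          B * ∑ n ∈ Icc 1 N, 1 / ((n : ℝ) * Real.log n) := by
      rw [Finset.mul_sum, ← Finset.sum_add_distrib]
      exact Finset.sum_congr rfl fun n _ => by ring
    rw [e, sum_Icc_one_div_mul_log_mul (fun n => |(bigOmega n : ℝ) - P n| - B)]
    linarith
  have hdiff : ∑ n ∈ Icc 1 N, 1 / ((n : ℝ) * Real.log n) * |(bigOmega n : ℝ) - logLog n| ≤
      ∑ n ∈ Icc 1 N, 1 / ((n : ℝ) * Real.log n) * |(bigOmega n : ℝ) - P n| +
        D * ∑ n ∈ Icc 1 N, 1 / ((n : ℝ) * Real.log n) := by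
    rw [Finset.mul_sum, ← Finset.sum_add_distrib]
    refine Finset.sum_le_sum fun n hn => ?_
    rcases (Finset.mem_Icc.1 hn).1.eq_or_lt with rfl | hn2
    · simp
    · have h3 := abs_sub_le (bigOmega n : ℝ) (P n) (logLog n)
      have h4 : |P n - logLog n| ≤ D := hP n hn2
      nlinarith [one_div_mul_log_nonneg n]
  have h5 : B * c₂ + B * ∑ n ∈ Icc 1 N, 1 / ((n : ℝ) * Real.log n) ≤
      B * ((c₂ + 1 + C₂) * L) := by
    rw [← mul_add]
    refine mul_le_mul_of_nonneg_left ?_ hB0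
    nlinarith
  have h6 : B * ((c₂ + 1 + C₂) * L) ≤ (C₁ + 2 * √(D + 2)) * √L * ((c₂ + 1 + C₂) * L) := by
    refine mul_le_mul_of_nonneg_right hBle ?_
    positivity
  have h7 : D * ∑ n ∈ Icc 1 N, 1 / ((n : ℝ) * Real.log n) ≤ D * (1 + C₂) * (L * √L) := by
    rw [mul_assoc]
    refine mul_le_mul_of_nonneg_left (hsum.trans ?_) hD
    exact mul_le_mul_of_nonneg_left (le_mul_of_one_le_right (by linarith) hs) (by positivity)
  calc _ ≤ _ := hdiff
    _ ≤ (C₁ + 2 * √(D + 2)) * √L * ((c₂ + 1 + C₂) * L) + D * (1 + C₂) * (L * √L) := by linarith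
    _ = _ := by ring

theorem sum_abs_dd_logLog_sub_le :
    ∃ C : ℝ, 0 ≤ C ∧ ∀ N : ℕ,
      ∑ n ∈ Icc 1 N, |dd logLog n - 1 / ((n : ℝ) * Real.log n)| ≤ C := by
  set c : ℕ → ℝ := fun n => 1 / ((n : ℝ) * Real.log n) with hc
  have hc0 : ∀ n, 0 ≤ c n := one_div_mul_log_nonneg
  set S := ∑ n ∈ Icc 1 3, |dd logLog n - c n|
  have hS : 0 ≤ S := Finset.sum_nonneg fun _ _ => abs_nonneg _
  refine ⟨S + c 3, add_nonneg hS (hc0 3), fun N => ?_⟩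
  rcases le_or_gt N 3 with hN | hN
  · exact (Finset.sum_le_sum_of_subset_of_nonneg (Finset.Icc_subset_Icc_right hN)
      fun _ _ _ => abs_nonneg _).trans (by linarith [hc0 3])
  · have : ∀ M, 3 ≤ M → ∑ n ∈ Icc 1 M, |dd logLog n - c n| ≤ S + c 3 - c M := by
      intro M hM
      induction M, hM using Nat.le_induction with
      | base => simp [S]
      | succ M hM ih =>
        rw [Finset.sum_Icc_succ_top (by omega), dd_logLog_succ, logLog_of_two_lt (by omega),
          logLog_of_two_lt (by omega)]
        have h := log_log_sub_mem (d := M) (by omega)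
        have h1 : c (M + 1) ≤ Real.log (Real.log ((M + 1 : ℕ) : ℝ)) - Real.log (Real.log M) := by
          simpa [hc] using h.1
        have h2 : Real.log (Real.log ((M + 1 : ℕ) : ℝ)) - Real.log (Real.log M) ≤ c M := by
          simpa [hc] using h.2
        rw [abs_of_nonneg (by linarith)]
        linarith
    linarith [this N hN.le, hc0 N]

/-! ### Moving averages -/

/-- The moving average `(1/H) ∑_{h < H} f(k + h)`. -/
noncomputable def movingAvg (f : ℕ → ℂ) (H k : ℕ) : ℂ := (1 / (H : ℂ)) * ∑ h ∈ range H, f (k + h)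

theorem norm_movingAvg_le {f : ℕ → ℂ} (hf : ∀ n, ‖f n‖ ≤ 1) (H k : ℕ) :
    ‖movingAvg f H k‖ ≤ 1 := by
  have h : ‖∑ h ∈ range H, f (k + h)‖ ≤ H := by
    simpa using norm_sum_le_of_le (range H) fun h _ => hf (k + h)
  rw [movingAvg, norm_mul, norm_div, norm_one, Complex.norm_natCast, one_div, ← div_eq_inv_mul]
  exact div_le_one_of_le₀ h (Nat.cast_nonneg H)

theorem norm_movingAvg_succ_sub_le {f : ℕ → ℂ} (hf : ∀ n, ‖f n‖ ≤ 1) (H k : ℕ) :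
    ‖movingAvg f H (k + 1) - movingAvg f H k‖ ≤ 2 / H := by
  have e : ∑ h ∈ range H, f (k + 1 + h) - ∑ h ∈ range H, f (k + h) = f (k + H) - f k := by
    rw [← Finset.sum_sub_distrib]
    simpa [add_assoc, add_comm 1] using Finset.sum_range_sub (fun h => f (k + h)) H
  rw [movingAvg, movingAvg, ← mul_sub, e, norm_mul, norm_div, norm_one, Complex.norm_natCast,
    div_eq_mul_one_div 2, mul_comm]
  refine mul_le_mul_of_nonneg_right ?_ (by positivity)
  linarith [norm_sub_le (f (k + H)) (f k), hf (k + H), hf k]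

theorem norm_sub_le_mul_abs_sub {g : ℕ → ℂ} {δ : ℝ} (hg : ∀ k, ‖g (k + 1) - g k‖ ≤ δ) (a b : ℕ) :
    ‖g a - g b‖ ≤ δ * |(a : ℝ) - b| := by
  have key : ∀ a n, ‖g (a + n) - g a‖ ≤ δ * n := by
    intro a n
    induction n with
    | zero => simp
    | succ n ih =>
      have := norm_sub_le_norm_sub_add_norm_sub (g (a + n + 1)) (g (a + n)) (g a)
      push_cast
      rw [← add_assoc]
      linarith [hg (a + n)]
  rcases le_total a b with h | h
  · obtain ⟨n, rfl⟩ := Nat.exists_eq_add_of_le h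
    rw [norm_sub_rev, abs_sub_comm]
    simpa using key a n
  · obtain ⟨n, rfl⟩ := Nat.exists_eq_add_of_le h
    simpa using key b n

/-- If a weighted mean changes by at most `C` when any bounded function is shifted by one, it
changes by at most `C * H` when a function is replaced by its moving average of length `H`. -/
theorem norm_sum_sub_sum_movingAvg_le {s : Finset ℕ} {w : ℕ → ℂ} {φ : ℕ → ℕ} {C : ℝ}
    (hC : 0 ≤ C)
    (h : ∀ f : ℕ → ℂ, (∀ n, ‖f n‖ ≤ 1) →
      ‖∑ n ∈ s, w n * f (φ n) - ∑ n ∈ s, w n * f (φ n + 1)‖ ≤ C)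
    {f : ℕ → ℂ} (hf : ∀ n, ‖f n‖ ≤ 1) {H : ℕ} (hH : 0 < H) :
    ‖∑ n ∈ s, w n * f (φ n) - ∑ n ∈ s, w n * movingAvg f H (φ n)‖ ≤ C * H := by
  have hshift : ∀ i : ℕ, ‖∑ n ∈ s, w n * f (φ n) - ∑ n ∈ s, w n * f (φ n + i)‖ ≤ C * i := by
    intro i
    induction i with
    | zero => simp
    | succ i ih =>
      have h1 := h (fun k => f (k + i)) fun n => hf _
      have h2 := norm_sub_le_norm_sub_add_norm_sub (∑ n ∈ s, w n * f (φ n))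
        (∑ n ∈ s, w n * f (φ n + i)) (∑ n ∈ s, w n * f (φ n + (i + 1)))
      simp only [add_assoc, add_comm 1] at h1
      push_cast
      linarith
  have hH' : (H : ℂ) ≠ 0 := by exact_mod_cast hH.ne'
  have e : ∑ n ∈ s, w n * f (φ n) - ∑ n ∈ s, w n * movingAvg f H (φ n) =
      (1 / (H : ℂ)) *
        ∑ i ∈ range H, (∑ n ∈ s, w n * f (φ n) - ∑ n ∈ s, w n * f (φ n + i)) := by
    rw [Finset.sum_sub_distrib, Finset.sum_const, Finset.card_range, nsmul_eq_mul, mul_sub,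
      ← mul_assoc, one_div_mul_cancel hH', one_mul, Finset.sum_comm, Finset.mul_sum]
    congr 1
    refine Finset.sum_congr rfl fun n _ => ?_
    rw [movingAvg, ← Finset.mul_sum]
    ring
  have h1 : ‖∑ i ∈ range H, (∑ n ∈ s, w n * f (φ n) - ∑ n ∈ s, w n * f (φ n + i))‖ ≤
      H * (C * H) := by
    have h2 := norm_sum_le_of_le (range H) (n := fun _ => C * H) fun i hi =>
      (hshift i).trans (mul_le_mul_of_nonneg_left
        (by exact_mod_cast (Finset.mem_range.1 hi).le) hC)
    simpa using h2
  have hH0 : (0 : ℝ) < H := by exact_mod_cast hH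
  rw [e, norm_mul, norm_div, norm_one, Complex.norm_natCast, one_div, ← div_eq_inv_mul,
    div_le_iff₀ hH0]
  linarith

theorem norm_sum_Icc_sub_sum_movingAvg_le {f : ℕ → ℂ} (hf : ∀ n, ‖f n‖ ≤ 1) (K : ℕ) {H : ℕ}
    (hH : 0 < H) :
    ‖∑ k ∈ Icc 1 K, f k - ∑ k ∈ Icc 1 K, movingAvg f H k‖ ≤ 2 * H := by
  have := norm_sum_sub_sum_movingAvg_le (s := Icc 1 K) (w := fun _ => 1) (φ := fun k => k)
    zero_le_two (fun f hf => ?_) hf hH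
  · simpa using this
  · have e : ∑ k ∈ Icc 1 K, f (k + 1) - ∑ k ∈ Icc 1 K, f k = f (K + 1) - f 1 := by
      induction K with
      | zero => simp
      | succ K ih =>
        rw [Finset.sum_Icc_succ_top (by omega), Finset.sum_Icc_succ_top (by omega),
          add_sub_add_comm, ih]
        ring
    simp only [one_mul]
    rw [norm_sub_rev, e]
    linarith [norm_sub_le (f (K + 1)) (f 1), hf (K + 1), hf 1]

/-- The integral over `[0, t]` of the step function `x ↦ g ⌊x⌋`. -/
noncomputable def stepIntegral (g : ℕ → ℂ) (t : ℝ) : ℂ :=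
  ∑ k ∈ range ⌊t⌋₊, g k + ((t - ⌊t⌋₊ : ℝ) : ℂ) * g ⌊t⌋₊

theorem norm_stepIntegral_sub_le {g : ℕ → ℂ} {δ : ℝ} (hg : ∀ k, ‖g (k + 1) - g k‖ ≤ δ) {a b : ℝ}
    (ha : 0 ≤ a) (hab : a ≤ b) (hba : b ≤ a + 1) :
    ‖((b - a : ℝ) : ℂ) * g ⌊b⌋₊ - (stepIntegral g b - stepIntegral g a)‖ ≤ δ * (b - a) := by
  have hδ : 0 ≤ δ := (norm_nonneg _).trans (hg 0)
  have h1 : ⌊a⌋₊ ≤ ⌊b⌋₊ := Nat.floor_mono hab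
  have h2 : ⌊b⌋₊ ≤ ⌊a⌋₊ + 1 := by
    rw [← Nat.floor_add_one ha]
    exact Nat.floor_mono hba
  have ha1 := Nat.lt_floor_add_one a
  have hb1 := Nat.floor_le (ha.trans hab)
  rcases (by omega : ⌊b⌋₊ = ⌊a⌋₊ ∨ ⌊b⌋₊ = ⌊a⌋₊ + 1) with h | h
  · rw [stepIntegral, stepIntegral, h]
    have : ((b - a : ℝ) : ℂ) * g ⌊a⌋₊ - (∑ k ∈ range ⌊a⌋₊, g k + ((b - ⌊a⌋₊ : ℝ) : ℂ) * g ⌊a⌋₊ -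
        (∑ k ∈ range ⌊a⌋₊, g k + ((a - ⌊a⌋₊ : ℝ) : ℂ) * g ⌊a⌋₊)) = 0 := by
      push_cast
      ring
    rw [this, norm_zero]
    exact mul_nonneg hδ (by linarith)
  · rw [stepIntegral, stepIntegral, h, Finset.sum_range_succ]
    rw [h] at hb1
    push_cast at hb1
    generalize ⌊a⌋₊ = m at *
    have : ((b - a : ℝ) : ℂ) * g (m + 1) - (∑ k ∈ range m, g k + g m +
        ((b - (m + 1 : ℕ) : ℝ) : ℂ) * g (m + 1) -
        (∑ k ∈ range m, g k + ((a - m : ℝ) : ℂ) * g m)) =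
        ((m + 1 - a : ℝ) : ℂ) * (g (m + 1) - g m) := by
      push_cast
      ring
    rw [this, norm_mul, Complex.norm_real, Real.norm_eq_abs, abs_of_nonneg (by linarith), mul_comm]
    exact mul_le_mul (hg m) (by linarith) (by linarith) hδ

theorem norm_sum_dd_logLog_mul_sub_stepIntegral_le {g : ℕ → ℂ} {δ : ℝ}
    (hg : ∀ k, ‖g (k + 1) - g k‖ ≤ δ) (N : ℕ) :
    ‖∑ n ∈ Icc 1 N, (dd logLog n : ℂ) * g ⌊logLog n⌋₊ - stepIntegral g (logLog N)‖ ≤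
      δ * logLog N := by
  induction N with
  | zero => simp [logLog_of_le_two, stepIntegral]
  | succ N ih =>
    have h := logLog_succ_sub_mem N
    have h1 := norm_stepIntegral_sub_le hg (logLog_nonneg N) (b := logLog (N + 1))
      (by linarith [h.1]) (by linarith [h.2])
    rw [Finset.sum_Icc_succ_top (by omega), dd_logLog_succ]
    have h2 := norm_add_le
      (∑ n ∈ Icc 1 N, (dd logLog n : ℂ) * g ⌊logLog n⌋₊ - stepIntegral g (logLog N))
      (((logLog (N + 1) - logLog N : ℝ) : ℂ) * g ⌊logLog (N + 1)⌋₊ -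
        (stepIntegral g (logLog (N + 1)) - stepIntegral g (logLog N)))
    rw [← add_sub_add_comm, add_sub_cancel] at h2
    linarith

theorem norm_stepIntegral_sub_sum_Icc_le {g : ℕ → ℂ} (hg : ∀ k, ‖g k‖ ≤ 1) {t : ℝ} (ht : 0 ≤ t) :
    ‖stepIntegral g t - ∑ k ∈ Icc 1 ⌊t⌋₊, g k‖ ≤ 3 := by
  have e : ∀ K : ℕ, ∑ k ∈ Icc 1 K, g k = ∑ k ∈ range K, g k + g K - g 0 := by
    intro K
    induction K with
    | zero => simp
    | succ K ih =>
      rw [Finset.sum_Icc_succ_top (by omega), Finset.sum_range_succ, ih]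
      ring
  rw [e, stepIntegral]
  have h1 := Nat.floor_le ht
  have h2 := Nat.lt_floor_add_one t
  have h3 : ‖((t - ⌊t⌋₊ : ℝ) : ℂ) * g ⌊t⌋₊‖ ≤ 1 := by
    rw [norm_mul, Complex.norm_real, Real.norm_eq_abs, abs_of_nonneg (by linarith)]
    exact mul_le_one₀ (by linarith) (norm_nonneg _) (hg _)
  have e2 : ∑ k ∈ range ⌊t⌋₊, g k + ((t - ⌊t⌋₊ : ℝ) : ℂ) * g ⌊t⌋₊ -
      (∑ k ∈ range ⌊t⌋₊, g k + g ⌊t⌋₊ - g 0) =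
      ((t - ⌊t⌋₊ : ℝ) : ℂ) * g ⌊t⌋₊ - g ⌊t⌋₊ + g 0 := by ring
  rw [e2]
  have h4 := norm_add_le (((t - ⌊t⌋₊ : ℝ) : ℂ) * g ⌊t⌋₊ - g ⌊t⌋₊) (g 0)
  have h5 := norm_sub_le (((t - ⌊t⌋₊ : ℝ) : ℂ) * g ⌊t⌋₊) (g ⌊t⌋₊)
  linarith [hg ⌊t⌋₊, hg 0]

/-! ### Comparison of the two averages -/

theorem norm_sum_dd_logLog_mul_sub_le :
    ∃ C : ℝ, 0 ≤ C ∧ ∀ N : ℕ, ∀ F : ℕ → ℂ, (∀ n, ‖F n‖ ≤ 1) →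
      ‖∑ n ∈ Icc 1 N, (dd logLog n : ℂ) * F n -
        ∑ n ∈ Icc 1 N, ((1 / ((n : ℝ) * Real.log n) : ℝ) : ℂ) * F n‖ ≤ C := by
  obtain ⟨C, hC, h⟩ := sum_abs_dd_logLog_sub_le
  refine ⟨C, hC, fun N F hF => ?_⟩
  rw [← Finset.sum_sub_distrib]
  refine (norm_sum_le_of_le _ fun n _ => ?_).trans (h N)
  rw [← sub_mul, ← Complex.ofReal_sub, norm_mul, Complex.norm_real, Real.norm_eq_abs]
  exact mul_le_of_le_one_right (abs_nonneg _) (hF n)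

theorem norm_sum_mul_bigOmega_sub_mul_floor_le :
    ∃ C : ℝ, 0 ≤ C ∧ ∀ N : ℕ, 1 ≤ logLog N → ∀ (g : ℕ → ℂ) (δ : ℝ),
      (∀ k, ‖g (k + 1) - g k‖ ≤ δ) →
      ‖∑ n ∈ Icc 1 N, ((1 / ((n : ℝ) * Real.log n) : ℝ) : ℂ) * g (bigOmega n) -
        ∑ n ∈ Icc 1 N, ((1 / ((n : ℝ) * Real.log n) : ℝ) : ℂ) * g ⌊logLog n⌋₊‖ ≤
        δ * (C * (logLog N * √(logLog N))) := by
  obtain ⟨C₁, hC₁, h₁⟩ := sum_one_div_mul_log_mul_abs_bigOmega_sub_le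
  obtain ⟨C₂, hC₂, h₂⟩ := sum_one_div_mul_log_le
  refine ⟨C₁ + (1 + C₂), by positivity, fun N hN g δ hg => ?_⟩
  have hδ : 0 ≤ δ := (norm_nonneg _).trans (hg 0)
  have hs : 1 ≤ √(logLog N) := Real.one_le_sqrt.2 hN
  have h3 : ∑ n ∈ Icc 1 N, 1 / ((n : ℝ) * Real.log n) ≤ (1 + C₂) * (logLog N * √(logLog N)) := by
    have h4 : logLog N ≤ logLog N * √(logLog N) := le_mul_of_one_le_right (by linarith) hs
    nlinarith [h₂ N]
  rw [← Finset.sum_sub_distrib]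
  calc _ ≤ ∑ n ∈ Icc 1 N, δ * (1 / ((n : ℝ) * Real.log n) * |(bigOmega n : ℝ) - logLog n| +
        1 / ((n : ℝ) * Real.log n)) := ?_
    _ ≤ _ := by
      rw [← Finset.mul_sum, Finset.sum_add_distrib]
      refine mul_le_mul_of_nonneg_left ?_ hδ
      linarith [h₁ N hN]
  refine norm_sum_le_of_le _ fun n _ => ?_
  have hc := one_div_mul_log_nonneg n
  rw [← mul_sub, norm_mul, Complex.norm_real, Real.norm_eq_abs, abs_of_nonneg hc]
  have h4 := norm_sub_le_mul_abs_sub hg (bigOmega n) ⌊logLog n⌋₊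
  have h5 : |(bigOmega n : ℝ) - ⌊logLog n⌋₊| ≤ |(bigOmega n : ℝ) - logLog n| + 1 := by
    have h6 := Nat.floor_le (logLog_nonneg n)
    have h7 := Nat.lt_floor_add_one (logLog n)
    have h8 := abs_sub_le (bigOmega n : ℝ) (logLog n) ⌊logLog n⌋₊
    rw [abs_of_nonneg (by linarith : 0 ≤ logLog n - (⌊logLog n⌋₊ : ℝ))] at h8
    linarith
  calc _ ≤ 1 / ((n : ℝ) * Real.log n) * (δ * (|(bigOmega n : ℝ) - logLog n| + 1)) :=
        mul_le_mul_of_nonneg_left (h4.trans (mul_le_mul_of_nonneg_left h5 hδ)) hc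
    _ = _ := by ring

theorem norm_sum_dd_logLog_mul_sub_sum_Icc_le :
    ∃ C : ℝ, 0 ≤ C ∧ ∀ N : ℕ, 1 ≤ logLog N → ∀ f : ℕ → ℂ, (∀ n, ‖f n‖ ≤ 1) →
      ∀ H : ℕ, 0 < H →
      ‖∑ n ∈ Icc 1 N, (dd logLog n : ℂ) * f (bigOmega n) - ∑ k ∈ Icc 1 ⌊logLog N⌋₊, f k‖ ≤
        C * (H + logLog N * √(logLog N) / H) := by
  obtain ⟨C₁, hC₁, h₁⟩ := norm_sum_dd_logLog_mul_sub_le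
  obtain ⟨C₂, hC₂, h₂⟩ := norm_sum_bigOmega_sub_shift_le
  obtain ⟨C₃, hC₃, h₃⟩ := norm_sum_mul_bigOmega_sub_mul_floor_le
  refine ⟨2 * C₁ + C₂ + 2 * C₃ + 7, by positivity, fun N hN f hf H hH => ?_⟩
  set g := movingAvg f H with hgdef
  have hg1 : ∀ k, ‖g k‖ ≤ 1 := norm_movingAvg_le hf H
  have hg : ∀ k, ‖g (k + 1) - g k‖ ≤ 2 / H := norm_movingAvg_succ_sub_le hf H
  have e1 := h₁ N (fun n => f (bigOmega n)) fun n => hf _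
  have e2 := norm_sum_sub_sum_movingAvg_le hC₂ (fun f hf => h₂ N f hf) hf hH
  have e3 := h₃ N hN g (2 / H) hg
  have e4 := h₁ N (fun n => g ⌊logLog n⌋₊) fun n => hg1 _
  have e5 := norm_sum_dd_logLog_mul_sub_stepIntegral_le hg N
  have e6 := norm_stepIntegral_sub_sum_Icc_le hg1 (logLog_nonneg N)
  have e7 := norm_sum_Icc_sub_sum_movingAvg_le hf ⌊logLog N⌋₊ hH
  rw [norm_sub_rev] at e4 e7
  rw [← hgdef] at e2 e7
  rw [← dist_eq_norm] at *
  have hH1 : (1 : ℝ) ≤ H := by exact_mod_cast hH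
  have hs : 1 ≤ √(logLog N) := Real.one_le_sqrt.2 hN
  set T := logLog N * √(logLog N) / H with hT
  have hT0 : 0 ≤ T := by positivity
  have h5 : 2 / (H : ℝ) * logLog N ≤ 2 * T := by
    rw [hT, div_mul_eq_mul_div, ← mul_div_assoc]
    refine div_le_div_of_nonneg_right ?_ (by positivity)
    nlinarith
  have h3 : 2 / (H : ℝ) * (C₃ * (logLog N * √(logLog N))) = 2 * C₃ * T := by
    rw [hT]
    ring
  rw [h3] at e3
  have key := (dist_triangle _ _ _).trans (add_le_add e1 <| (dist_triangle _ _ _).trans <|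
    add_le_add e2 <| (dist_triangle _ _ _).trans <| add_le_add e3 <|
    (dist_triangle _ _ _).trans <| add_le_add e4 <| (dist_triangle _ _ _).trans <|
    add_le_add (e5.trans h5) <| (dist_triangle _ _ _).trans <| add_le_add e6 e7)
  refine key.trans ?_
  nlinarith [mul_nonneg hC₁ hT0, mul_nonneg hC₂ hT0, mul_le_mul_of_nonneg_left hH1 hC₁,
    mul_nonneg hC₃ (by linarith : (0 : ℝ) ≤ H)]

theorem norm_wAvg_logLog_sub_cesaro_le :
    ∃ C : ℝ, 0 ≤ C ∧ ∀ N : ℕ, 1 ≤ logLog N → ∀ f : ℕ → ℂ, (∀ n, ‖f n‖ ≤ 1) →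
      ‖wAvg logLog (fun n => f (bigOmega n)) N - cesaro f ⌊logLog N⌋₊‖ ≤ C / √√(logLog N) := by
  obtain ⟨C, hC, hbound⟩ := norm_sum_dd_logLog_mul_sub_sum_Icc_le
  refine ⟨3 * C + 1, by positivity, fun N hN f hf => ?_⟩
  set L := logLog N
  set s := √√L
  have hs : 1 ≤ s := Real.one_le_sqrt.2 (Real.one_le_sqrt.2 hN)
  have hs2 : √L = s ^ 2 := (Real.sq_sqrt (Real.sqrt_nonneg _)).symm
  have hL : L = s ^ 4 := by
    rw [← Real.sq_sqrt (by linarith : 0 ≤ L), hs2]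
    ring
  set K := ⌊L⌋₊
  have hK : 0 < K := Nat.floor_pos.2 hN
  have hKL : (K : ℝ) ≤ L := Nat.floor_le (by linarith)
  have hLK : L < K + 1 := Nat.lt_floor_add_one L
  have hs3 : 1 ≤ s ^ 3 := one_le_pow₀ hs
  have hH : 0 < ⌈s ^ 3⌉₊ := Nat.ceil_pos.2 (by linarith)
  have h := hbound N hN f hf ⌈s ^ 3⌉₊ hH
  have hH1 := Nat.le_ceil (s ^ 3)
  have hH2 := Nat.ceil_lt_add_one (by positivity : 0 ≤ s ^ 3)
  have hT : L * √L / ⌈s ^ 3⌉₊ ≤ s ^ 3 := by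
    rw [div_le_iff₀ (by positivity), hs2, hL]
    calc s ^ 4 * s ^ 2 = s ^ 3 * s ^ 3 := by ring
      _ ≤ _ := mul_le_mul_of_nonneg_left hH1 (by positivity)
  have hX : ‖∑ n ∈ Icc 1 N, (dd logLog n : ℂ) * f (bigOmega n) - ∑ k ∈ Icc 1 K, f k‖ ≤
      C * (3 * s ^ 3) := h.trans (mul_le_mul_of_nonneg_left (by linarith) hC)
  have hY : ‖∑ k ∈ Icc 1 K, f k‖ ≤ K := by
    simpa using norm_sum_le_of_le (Icc 1 K) fun k _ => hf k
  have hK' : (K : ℂ) ≠ 0 := by exact_mod_cast hK.ne'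
  have hK0 : (0 : ℝ) < K := by exact_mod_cast hK
  have hL0 : 0 < L := by linarith
  have hL' : (L : ℂ) ≠ 0 := by exact_mod_cast hL0.ne'
  have e : wAvg logLog (fun n => f (bigOmega n)) N - cesaro f K =
      (1 / (L : ℂ)) *
        ((∑ n ∈ Icc 1 N, (dd logLog n : ℂ) * f (bigOmega n) - ∑ k ∈ Icc 1 K, f k) -
          (((L - K) / K : ℝ) : ℂ) * ∑ k ∈ Icc 1 K, f k) := by
    rw [wAvg, cesaro]
    change 1 / (L : ℂ) * _ - _ = _
    push_cast
    field_simp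
    ring
  have h2 : ‖(((L - K) / K : ℝ) : ℂ) * ∑ k ∈ Icc 1 K, f k‖ ≤ 1 := by
    rw [norm_mul, Complex.norm_real, Real.norm_eq_abs,
      abs_of_nonneg (div_nonneg (by linarith) hK0.le), div_mul_eq_mul_div, div_le_one hK0]
    nlinarith [norm_nonneg (∑ k ∈ Icc 1 K, f k)]
  have h3 := norm_sub_le
    (∑ n ∈ Icc 1 N, (dd logLog n : ℂ) * f (bigOmega n) - ∑ k ∈ Icc 1 K, f k)
    ((((L - K) / K : ℝ) : ℂ) * ∑ k ∈ Icc 1 K, f k)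
  rw [e, norm_mul, norm_div, norm_one, Complex.norm_real, Real.norm_eq_abs, abs_of_pos hL0,
    one_div, ← div_eq_inv_mul, div_le_div_iff₀ hL0 (by linarith)]
  calc _ ≤ (C * (3 * s ^ 3) + 1) * s := mul_le_mul_of_nonneg_right (by linarith) (by linarith)
    _ ≤ (3 * C + 1) * L := by
      rw [hL]
      nlinarith [mul_le_mul_of_nonneg_right hs3 (by linarith : 0 ≤ s)]

/-- double-logarithmic averages of `f(Ω(n))` agree with Cesàro averages
of `f` at scale `⌊log log N⌋`, uniformly over `f` with `‖f‖_∞ ≤ 1`. -/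
theorem stmt4 (Wll : ℕ → ℝ)
    (hWll : ∀ N : ℕ, Wll N = if N ≤ 2 then 0 else Real.log (Real.log N)) :
    ∀ ε : ℝ, 0 < ε → ∀ᶠ N : ℕ in atTop, ∀ f : ℕ → ℂ, (∀ n, ‖f n‖ ≤ 1) →
      ‖wAvg Wll (fun n => f (bigOmega n)) N -
        cesaro f ⌊Real.log (Real.log N)⌋₊‖ < ε := by
  intro ε hε
  obtain rfl : Wll = logLog := funext hWll
  obtain ⟨C, _, h⟩ := norm_wAvg_logLog_sub_cesaro_le
  have hlim : Tendsto (fun N : ℕ => Real.log (Real.log N)) atTop atTop :=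
    Real.tendsto_log_atTop.comp (Real.tendsto_log_atTop.comp tendsto_natCast_atTop_atTop)
  have hC : Tendsto (fun N : ℕ => C / √√(Real.log (Real.log N))) atTop (nhds 0) :=
    (Real.tendsto_sqrt_atTop.comp (Real.tendsto_sqrt_atTop.comp hlim)).const_div_atTop C
  filter_upwards [hC.eventually_lt_const hε, hlim.eventually_ge_atTop 1,
    eventually_gt_atTop 2] with N h1 h2 h3 f hf
  rw [← logLog_of_two_lt h3] at h1 h2 ⊢
  exact (h N h2 f hf).trans_lt h1
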